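/- arXiv:2410.00329 — 3 statements merged into one kernel-verified Lean document; each statement's English description precedes it below -/
import Mathlib

section
/- Fix real numbers α, β with 0 < α < 1 and 0 < β < 1. For real numbers M₁, M₂ ≥ 2, H ≥ 1 and a real number Δ > 0, set t(h,m₁,m₂) = (m₁^α − m₂^α) h^β, and let 𝓑(M₁,M₂,H,Δ) be the number of six-tuples (m₁, m̃₁, m₂, m̃₂, h, h̃) of positive integers with m₁, m̃₁ ~ M₁, m₂, m̃₂ ~ M₂, h, h̃ ~ H, m₁ ≠ m₂, m̃₁ ≠ m̃₂, satisfying |t(h,m₁,m₂) − t(h̃,m̃₁,m̃₂)| ≤ Δ. Then for every ε > 0, 𝓑(M₁,M₂,H,Δ) ≪ (M₁M₂)^{3/2+ε} H^{3/2} + M₁^{2−α/4+ε} M₂^{3/2+ε} Δ^{1/4} H^{3/2−β/4} + (M₁M₂)^{2−α/2+ε} H^{2−β} Δ, where the implied constant depends only on α, β, ε. -/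
open Real Finset

/-- `𝓑(M₁,M₂,H,Δ)`: the number of six-tuples `(m₁, m̃₁, m₂, m̃₂, h, h̃)` of positive
integers with `m₁, m̃₁ ~ M₁`, `m₂, m̃₂ ~ M₂`, `h, h̃ ~ H`, `m₁ ≠ m₂`, `m̃₁ ≠ m̃₂` and
`|(m₁^α − m₂^α) h^β − (m̃₁^α − m̃₂^α) h̃^β| ≤ Δ`. -/
noncomputable def Bcount (α β M₁ M₂ H Δ : ℝ) : ℕ :=
  ((Finset.Ioc ⌊M₁⌋₊ ⌊2*M₁⌋₊ ×ˢ Finset.Ioc ⌊M₁⌋₊ ⌊2*M₁⌋₊ ×ˢ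
    Finset.Ioc ⌊M₂⌋₊ ⌊2*M₂⌋₊ ×ˢ Finset.Ioc ⌊M₂⌋₊ ⌊2*M₂⌋₊ ×ˢ
    Finset.Ioc ⌊H⌋₊ ⌊2*H⌋₊ ×ˢ Finset.Ioc ⌊H⌋₊ ⌊2*H⌋₊).filter
      (fun t : ℕ × ℕ × ℕ × ℕ × ℕ × ℕ =>
        t.1 ≠ t.2.2.1 ∧ t.2.1 ≠ t.2.2.2.1 ∧
        |((t.1 : ℝ)^α - (t.2.2.1 : ℝ)^α) * (t.2.2.2.2.1 : ℝ)^β -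
          ((t.2.1 : ℝ)^α - (t.2.2.2.1 : ℝ)^α) * (t.2.2.2.2.2 : ℝ)^β| ≤ Δ)).card

/-- Points at mutual distance at least `γ` inside an interval of length `2 * δ`. -/
theorem card_le_of_spaced {ι : Type*} (S : Finset ι) (f : ι → ℝ) (c δ γ : ℝ)
    (hγ : 0 < γ) (hδ : 0 ≤ δ) (hf : ∀ x ∈ S, |f x - c| ≤ δ)
    (hs : ∀ x ∈ S, ∀ y ∈ S, x ≠ y → γ ≤ |f x - f y|) :
    (S.card : ℝ) ≤ 1 + 2 * δ / γ := by
  have h0 : 0 ≤ 2 * δ / γ := by positivity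
  have key : S.card ≤ (Finset.range (⌊2 * δ / γ⌋₊ + 1)).card := by
    apply Finset.card_le_card_of_injOn (fun x => ⌊(f x - (c - δ)) / γ⌋₊)
    · intro x hx
      have h1 := abs_le.1 (hf x hx)
      simp only [Finset.coe_range, Set.mem_Iio]
      refine Nat.lt_succ_of_le (Nat.floor_le_floor ?_)
      gcongr
      linarith
    · intro x hx y hy hxy
      by_contra hne
      have h1 := abs_le.1 (hf x hx)
      have h2 := abs_le.1 (hf y hy)
      have h3 := hs x hx y hy hne
      simp only at hxy
      have h4 : 0 ≤ (f x - (c - δ)) / γ := div_nonneg (by linarith) hγ.le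
      have h5 : 0 ≤ (f y - (c - δ)) / γ := div_nonneg (by linarith) hγ.le
      have a1 := Nat.floor_le h4
      have a2 := Nat.lt_floor_add_one ((f x - (c - δ)) / γ)
      have a3 := Nat.floor_le h5
      have a4 := Nat.lt_floor_add_one ((f y - (c - δ)) / γ)
      rw [hxy] at a1 a2
      have h6 : |(f x - (c - δ)) / γ - (f y - (c - δ)) / γ| < 1 := by
        rw [abs_lt]; constructor <;> linarith
      rw [← sub_div, abs_div, abs_of_pos hγ, div_lt_one hγ] at h6
      have h7 : f x - (c - δ) - (f y - (c - δ)) = f x - f y := by ring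
      rw [h7] at h6
      linarith
  rw [Finset.card_range] at key
  have h1 : (S.card : ℝ) ≤ (⌊2 * δ / γ⌋₊ : ℝ) + 1 := by exact_mod_cast key
  linarith [Nat.floor_le h0]

theorem card_le_sum_of_fiber {ι κ : Type*} [DecidableEq κ] (S : Finset ι) (B : Finset κ)
    (p : ι → κ) (w : κ → ℝ) (hp : ∀ x ∈ S, p x ∈ B)
    (hw : ∀ b ∈ B, ((S.filter (fun x => p x = b)).card : ℝ) ≤ w b) :
    (S.card : ℝ) ≤ ∑ b ∈ B, w b := by
  rw [Finset.card_eq_sum_card_fiberwise (f := p) (t := B) hp]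
  push_cast
  exact Finset.sum_le_sum hw

theorem card_filter_prod_eq_sum {ι κ : Type*} [DecidableEq κ] (X : Finset ι)
    (u v : ι → κ) (Z : Finset κ) (hu : ∀ x ∈ X, u x ∈ Z) :
    ((X ×ˢ X).filter (fun p => u p.1 = v p.2)).card
      = ∑ z ∈ Z, (X.filter (fun x => u x = z)).card * (X.filter (fun x => v x = z)).card := by
  rw [Finset.card_eq_sum_card_fiberwise (f := fun p : ι × ι => u p.1) (t := Z)]
  · refine Finset.sum_congr rfl fun z _ => ?_
    rw [← Finset.card_product]
    congr 1
    ext ⟨x, y⟩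
    simp only [Finset.mem_filter, Finset.mem_product]
    constructor
    · rintro ⟨⟨⟨a, b⟩, c⟩, d⟩
      exact ⟨⟨a, d⟩, b, c ▸ d⟩
    · rintro ⟨⟨a, d⟩, b, e⟩
      exact ⟨⟨⟨a, b⟩, d.trans e.symm⟩, d⟩
  · intro p hp
    exact hu _ (Finset.mem_product.1 (Finset.mem_filter.1 hp).1).1

/-- Cauchy–Schwarz: pairs of points at distance at most `Δ` are controlled by such pairs lying
in a common class. -/
theorem card_close_pairs_le {ι κ : Type*} [DecidableEq κ] (X : Finset ι) (f : ι → ℝ)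
    (cl : ι → κ) (K : Finset κ) (hK : ∀ x ∈ X, cl x ∈ K) (Δ : ℝ) (hΔ : 0 < Δ) :
    ((X ×ˢ X).filter (fun p => |f p.1 - f p.2| ≤ Δ)).card
      ≤ 3 * (K.card *
        ((X ×ˢ X).filter (fun p => cl p.1 = cl p.2 ∧ |f p.1 - f p.2| ≤ Δ)).card) := by
  set b : ι → ℤ := fun x => ⌊f x / Δ⌋ with hb
  set E := ((X ×ˢ X).filter (fun p => b p.1 = b p.2)).card with hE
  have shift : ∀ e : ℤ, ((X ×ˢ X).filter (fun p => b p.1 + e = b p.2)).card ≤ E := by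
    intro e
    set Z := X.image (fun x => b x + e) ∪ X.image b with hZ
    have h1 : ∀ x ∈ X, b x + e ∈ Z := fun x hx =>
      Finset.mem_union_left _ (Finset.mem_image_of_mem (fun x => b x + e) hx)
    have h2 : ∀ x ∈ X, b x ∈ Z := fun x hx =>
      Finset.mem_union_right _ (Finset.mem_image_of_mem b hx)
    have e1 := card_filter_prod_eq_sum X (fun x => b x + e) b Z h1
    have e2 := card_filter_prod_eq_sum X (fun x => b x + e) (fun x => b x + e) Z h1
    have e3 := card_filter_prod_eq_sum X b b Z h2
    simp only [add_left_inj] at e2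
    have h3 : 2 * ((X ×ˢ X).filter (fun p => b p.1 + e = b p.2)).card ≤ E + E := by
      conv_rhs => rw [hE]
      nth_rewrite 1 [e2]
      rw [e1, e3, Finset.mul_sum, ← Finset.sum_add_distrib]
      refine Finset.sum_le_sum fun z _ => ?_
      nlinarith [two_mul_le_add_sq (X.filter (fun x => b x + e = z)).card
        (X.filter (fun x => b x = z)).card]
    omega
  have hsub : ((X ×ˢ X).filter (fun p => |f p.1 - f p.2| ≤ Δ)).card ≤ 3 * E := by
    classical
    calc _ ≤ (((X ×ˢ X).filter (fun p => b p.1 + (-1) = b p.2)) ∪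
          ((X ×ˢ X).filter (fun p => b p.1 + 0 = b p.2)) ∪
          ((X ×ˢ X).filter (fun p => b p.1 + 1 = b p.2))).card := by
          apply Finset.card_le_card
          intro p hp
          rw [Finset.mem_filter] at hp
          simp only [Finset.mem_union, Finset.mem_filter, hp.1, true_and]
          have h1 := abs_le.1 hp.2
          have h2 : f p.1 / Δ ≤ f p.2 / Δ + 1 := by
            rw [div_add_one hΔ.ne']; gcongr; linarith
          have h3 : f p.2 / Δ ≤ f p.1 / Δ + 1 := by
            rw [div_add_one hΔ.ne']; gcongr; linarith
          have h4 : b p.1 ≤ b p.2 + 1 := by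
            rw [hb]; simp only [← Int.floor_add_one]; exact Int.floor_le_floor h2
          have h5 : b p.2 ≤ b p.1 + 1 := by
            rw [hb]; simp only [← Int.floor_add_one]; exact Int.floor_le_floor h3
          omega
      _ ≤ _ := by
          refine (Finset.card_union_le _ _).trans ?_
          have := Finset.card_union_le ((X ×ˢ X).filter (fun p => b p.1 + (-1) = b p.2))
            ((X ×ˢ X).filter (fun p => b p.1 + 0 = b p.2))
          have := shift (-1)
          have := shift 0
          have := shift 1
          omega
  refine hsub.trans (Nat.mul_le_mul_left 3 ?_)
  have e3 := card_filter_prod_eq_sum X b b (X.image b) fun x hx => Finset.mem_image_of_mem b hx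
  have e4 := card_filter_prod_eq_sum X (fun x => (b x, cl x)) (fun x => (b x, cl x))
    (X.image b ×ˢ K) fun x hx =>
      Finset.mem_product.2 ⟨Finset.mem_image_of_mem b hx, hK x hx⟩
  calc E ≤ K.card * ((X ×ˢ X).filter
        (fun p => (b p.1, cl p.1) = (b p.2, cl p.2))).card := by
        rw [hE, e3, e4, Finset.sum_product, Finset.mul_sum]
        refine Finset.sum_le_sum fun z _ => ?_
        have h1 : (X.filter (fun x => b x = z)).card
            = ∑ k ∈ K, (X.filter (fun x => (b x, cl x) = (z, k))).card := by
          rw [Finset.card_eq_sum_card_fiberwise (f := cl) (t := K)]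
          · refine Finset.sum_congr rfl fun k _ => ?_
            rw [Finset.filter_filter]
            simp only [Prod.mk.injEq]
          · intro x hx
            exact hK x (Finset.mem_filter.1 hx).1
        rw [h1, ← sq]
        refine sq_sum_le_card_mul_sum_sq.trans (le_of_eq ?_)
        simp only [sq, Nat.cast_id]
    _ ≤ _ := by
        refine Nat.mul_le_mul_left _ (Finset.card_le_card ?_)
        intro p hp
        simp only [Finset.mem_filter, Prod.mk.injEq] at hp ⊢
        refine ⟨hp.1, hp.2.2, ?_⟩
        have h1 : |f p.1 / Δ - f p.2 / Δ| < 1 := Int.abs_sub_lt_one_of_floor_eq_floor hp.2.1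
        rw [← sub_div, abs_div, abs_of_pos hΔ, div_lt_one hΔ] at h1
        exact h1.le

theorem exists_sub_eq_deriv_mul (f f' : ℝ → ℝ) (x y : ℝ)
    (h : ∀ t ∈ Set.uIcc x y, HasDerivAt f (f' t) t) :
    ∃ ξ ∈ Set.uIcc x y, f x - f y = f' ξ * (x - y) := by
  rcases lt_trichotomy x y with hxy | hxy | hxy
  · rw [Set.uIcc_of_le hxy.le] at h ⊢
    obtain ⟨ξ, hξ, e⟩ := exists_hasDerivAt_eq_slope f f' hxy
      (fun t ht => (h t ht).continuousAt.continuousWithinAt)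
      (fun t ht => h t (Set.Ioo_subset_Icc_self ht))
    refine ⟨ξ, Set.Ioo_subset_Icc_self hξ, ?_⟩
    rw [e]; field_simp [(sub_pos.2 hxy).ne']; ring
  · subst hxy
    exact ⟨x, by simp, by simp⟩
  · rw [Set.uIcc_of_ge hxy.le] at h ⊢
    obtain ⟨ξ, hξ, e⟩ := exists_hasDerivAt_eq_slope f f' hxy
      (fun t ht => (h t ht).continuousAt.continuousWithinAt)
      (fun t ht => h t (Set.Ioo_subset_Icc_self ht))
    refine ⟨ξ, Set.Ioo_subset_Icc_self hξ, ?_⟩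
    rw [e, div_mul_cancel₀ _ (sub_pos.2 hxy).ne']

theorem exists_rpow_sub_rpow_eq (s : ℝ) {a b x y : ℝ} (ha : 0 < a) (hx : x ∈ Set.Icc a b)
    (hy : y ∈ Set.Icc a b) :
    ∃ ξ ∈ Set.Icc a b, x ^ s - y ^ s = s * ξ ^ (s - 1) * (x - y) := by
  obtain ⟨ξ, hξ, e⟩ := exists_sub_eq_deriv_mul (fun t => t ^ s) (fun t => s * t ^ (s - 1)) x y
    (fun t ht => Real.hasDerivAt_rpow_const
      (Or.inl (ha.trans_le (Set.uIcc_subset_Icc hx hy ht).1).ne'))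
  exact ⟨ξ, Set.uIcc_subset_Icc hx hy hξ, e⟩

theorem mul_abs_sub_le_abs_rpow_sub {s N x y : ℝ} (hs0 : 0 < s) (hs1 : s ≤ 1) (hx : 0 < x)
    (hy : 0 < y) (hxN : x ≤ N) (hyN : y ≤ N) :
    s * N ^ (s - 1) * |x - y| ≤ |x ^ s - y ^ s| := by
  obtain ⟨ξ, hξ, e⟩ := exists_rpow_sub_rpow_eq s (lt_min hx hy)
    (⟨min_le_left _ _, hxN⟩ : x ∈ Set.Icc (min x y) N) ⟨min_le_right _ _, hyN⟩
  have h0 : 0 < ξ := (lt_min hx hy).trans_le hξ.1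
  rw [e, abs_mul, abs_of_pos (by positivity : 0 < s * ξ ^ (s - 1))]
  gcongr ?_ * _
  gcongr ?_ * ?_
  exact Real.rpow_le_rpow_of_nonpos h0 hξ.2 (by linarith)

theorem abs_rpow_sub_le {s N x y : ℝ} (hs0 : 0 < s) (hs1 : s ≤ 1) (hN : 0 < N)
    (hxN : N ≤ x) (hyN : N ≤ y) :
    |x ^ s - y ^ s| ≤ s * N ^ (s - 1) * |x - y| := by
  obtain ⟨ξ, hξ, e⟩ := exists_rpow_sub_rpow_eq s hN
    (⟨hxN, le_max_left _ _⟩ : x ∈ Set.Icc N (max x y)) ⟨hyN, le_max_right _ _⟩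
  have h0 : 0 < ξ := hN.trans_le hξ.1
  rw [e, abs_mul, abs_of_pos (by positivity : 0 < s * ξ ^ (s - 1))]
  gcongr ?_ * _
  gcongr ?_ * ?_
  exact Real.rpow_le_rpow_of_nonpos hN hξ.1 (by linarith)

theorem mul_abs_sub_le_abs_rpow_diff_sub {s N a x y : ℝ} (hs0 : 0 < s) (hs1 : s < 1)
    (ha : 0 < a) (hx : 0 < x) (hy : 0 < y) (hxN : x + a ≤ N) (hyN : y + a ≤ N) :
    s * (1 - s) * N ^ (s - 2) * a * |x - y|
      ≤ |((x + a) ^ s - x ^ s) - ((y + a) ^ s - y ^ s)| := by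
  have hm : 0 < min x y := lt_min hx hy
  have hI : Set.uIcc x y ⊆ Set.Icc (min x y) (N - a) :=
    Set.uIcc_subset_Icc ⟨min_le_left _ _, by linarith⟩ ⟨min_le_right _ _, by linarith⟩
  obtain ⟨ξ, hξ, e⟩ := exists_sub_eq_deriv_mul (fun t => (t + a) ^ s - t ^ s)
    (fun t => s * (t + a) ^ (s - 1) - s * t ^ (s - 1)) x y (fun t ht => by
      have h0 : 0 < t := hm.trans_le (hI ht).1
      have h1 := ((hasDerivAt_id' t).add_const a).rpow_const (p := s)
        (Or.inl (by positivity : t + a ≠ 0))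
      have h2 := Real.hasDerivAt_rpow_const (x := t) (p := s) (Or.inl h0.ne')
      rw [one_mul] at h1
      exact h1.sub h2)
  have h0 : 0 < ξ := hm.trans_le (hI hξ).1
  have hξN := (hI hξ).2
  obtain ⟨ζ, hζ, e'⟩ := exists_rpow_sub_rpow_eq (s - 1) h0
    (⟨by linarith, by linarith⟩ : ξ + a ∈ Set.Icc ξ N) ⟨le_rfl, by linarith⟩
  have h1 : 0 < ζ := h0.trans_le hζ.1
  rw [e, ← mul_sub, e']
  have h2 : s * ((s - 1) * ζ ^ (s - 1 - 1) * (ξ + a - ξ)) * (x - y)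
      = -(s * (1 - s) * ζ ^ (s - 2) * a * (x - y)) := by
    rw [show s - 1 - 1 = s - 2 by ring]; ring
  have h3 : 0 < 1 - s := by linarith
  rw [h2, abs_neg, abs_mul, abs_of_pos (by positivity : 0 < s * (1 - s) * ζ ^ (s - 2) * a)]
  gcongr ?_ * _
  gcongr ?_ * _
  gcongr _ * ?_
  exact Real.rpow_le_rpow_of_nonpos h1 hζ.2 (by linarith)

/-- The integers `m ~ M`. -/
noncomputable abbrev dyad (M : ℝ) : Finset ℕ := Finset.Ioc ⌊M⌋₊ ⌊2 * M⌋₊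

theorem lt_of_mem_dyad {M : ℝ} {m : ℕ} (h : m ∈ dyad M) : M < m :=
  Nat.lt_of_floor_lt (Finset.mem_Ioc.1 h).1

theorem le_of_mem_dyad {M : ℝ} (hM : 0 ≤ M) {m : ℕ} (h : m ∈ dyad M) : (m : ℝ) ≤ 2 * M :=
  (Nat.le_floor_iff (by linarith)).1 (Finset.mem_Ioc.1 h).2

theorem card_dyad_le {M : ℝ} (hM : 0 ≤ M) : ((dyad M).card : ℝ) ≤ 2 * M := by
  rw [Nat.card_Ioc]
  exact (Nat.cast_le.2 (Nat.sub_le _ _)).trans (Nat.floor_le (by linarith))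

theorem sum_Icc_inv_le {M : ℝ} (hM : 1 ≤ M) :
    ∑ d ∈ Finset.Icc 1 ⌊M⌋₊, ((d : ℝ))⁻¹ ≤ 1 + Real.log M := by
  have h1 := harmonic_le_one_add_log ⌊M⌋₊
  rw [harmonic_eq_sum_Icc] at h1
  push_cast at h1
  refine h1.trans ?_
  have : 0 < ⌊M⌋₊ := Nat.floor_pos.2 hM
  have := Nat.floor_le (by linarith : 0 ≤ M)
  gcongr

theorem one_le_abs_natCast_sub {a b : ℕ} (h : a ≠ b) : (1 : ℝ) ≤ |(a : ℝ) - b| := by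
  have h1 : (1 : ℤ) ≤ |(a : ℤ) - b| := Int.one_le_abs (by omega)
  exact_mod_cast h1

theorem card_diff_pos_le {s M v δ : ℝ} (hs0 : 0 < s) (hs1 : s < 1) (hM : 1 ≤ M) (hδ : 0 ≤ δ) :
    (((dyad M ×ˢ dyad M).filter
      (fun p => p.2 < p.1 ∧ |(p.1 : ℝ) ^ s - (p.2 : ℝ) ^ s - v| ≤ δ)).card : ℝ)
      ≤ (|v| + δ) / (s * (2 * M) ^ (s - 1))
        + 2 * δ / (s * (1 - s) * (2 * M) ^ (s - 2)) * (1 + Real.log (2 * M)) := by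
  have hM0 : 0 < M := by linarith
  have h1s : 0 < 1 - s := by linarith
  set A := (|v| + δ) / (s * (2 * M) ^ (s - 1)) with hA
  have hA0 : 0 ≤ A := by positivity
  set c := s * (1 - s) * (2 * M) ^ (s - 2) with hc
  have hc0 : 0 < c := by positivity
  refine (card_le_sum_of_fiber _ ((Finset.Icc 1 ⌊2 * M⌋₊).filter (fun a : ℕ => (a : ℝ) ≤ A))
    (fun p : ℕ × ℕ => p.1 - p.2) (fun a : ℕ => 1 + 2 * δ / c * ((a : ℝ))⁻¹) ?_ ?_).trans ?_
  · rintro ⟨x, y⟩ hp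
    simp only [Finset.mem_filter, Finset.mem_product] at hp
    obtain ⟨⟨hx, hy⟩, hlt, hv⟩ := hp
    have hx1 := lt_of_mem_dyad hx
    have hy1 := lt_of_mem_dyad hy
    have hx2 := le_of_mem_dyad hM0.le hx
    have hy2 := le_of_mem_dyad hM0.le hy
    simp only [Finset.mem_filter, Finset.mem_Icc]
    refine ⟨⟨by omega, ?_⟩, ?_⟩
    · have := (Finset.mem_Ioc.1 hx).2
      omega
    · rw [Nat.cast_sub hlt.le, hA, le_div_iff₀ (by positivity)]
      have h1 := mul_abs_sub_le_abs_rpow_sub hs0 hs1.le (hM0.trans hx1) (hM0.trans hy1) hx2 hy2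
      have h2 : |(x : ℝ) ^ s - (y : ℝ) ^ s| ≤ |v| + δ := by
        have := abs_add_le ((x : ℝ) ^ s - (y : ℝ) ^ s - v) v
        rw [sub_add_cancel] at this
        linarith
      have h3 : (x : ℝ) - y ≤ |(x : ℝ) - y| := le_abs_self _
      have h4 : 0 < s * (2 * M) ^ (s - 1) := by positivity
      nlinarith
  · intro a ha
    simp only [Finset.mem_filter, Finset.mem_Icc] at ha
    have ha0 : (0 : ℝ) < a := by exact_mod_cast ha.1.1
    have key := card_le_of_spaced
      (((dyad M ×ˢ dyad M).filter
        (fun p => p.2 < p.1 ∧ |(p.1 : ℝ) ^ s - (p.2 : ℝ) ^ s - v| ≤ δ)).filter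
          (fun p => p.1 - p.2 = a))
      (fun p => (p.1 : ℝ) ^ s - (p.2 : ℝ) ^ s) v δ (c * a) (by positivity) hδ
      (fun p hp => (Finset.mem_filter.1 (Finset.mem_filter.1 hp).1).2.2) ?_
    · refine key.trans (le_of_eq ?_)
      field_simp
    · rintro ⟨x, y⟩ hp ⟨x', y'⟩ hp' hne
      simp only [Finset.mem_filter, Finset.mem_product] at hp hp'
      obtain ⟨⟨⟨hx, hy⟩, hlt, -⟩, hxy⟩ := hp
      obtain ⟨⟨⟨hx', hy'⟩, hlt', -⟩, hxy'⟩ := hp'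
      have e1 : x = y + a := by omega
      have e2 : x' = y' + a := by omega
      subst e1 e2
      have hyy : y ≠ y' := fun h => hne (by rw [h])
      have h1 := le_of_mem_dyad hM0.le hx
      have h1' := le_of_mem_dyad hM0.le hx'
      push_cast at h1 h1'
      have h2 := mul_abs_sub_le_abs_rpow_diff_sub hs0 hs1 ha0
        (hM0.trans (lt_of_mem_dyad hy)) (hM0.trans (lt_of_mem_dyad hy')) h1 h1'
      push_cast
      have h3 := one_le_abs_natCast_sub hyy
      have h4 : c * a ≤ c * a * |(y : ℝ) - y'| := le_mul_of_one_le_right (by positivity) h3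
      exact h4.trans h2
  · rw [Finset.sum_add_distrib, ← Finset.mul_sum]
    gcongr
    · rw [Finset.sum_const, nsmul_eq_mul, mul_one]
      have : ((Finset.Icc 1 ⌊2 * M⌋₊).filter (fun a : ℕ => (a : ℝ) ≤ A)) ⊆ Finset.Icc 1 ⌊A⌋₊ := by
        intro a ha
        simp only [Finset.mem_filter, Finset.mem_Icc] at ha ⊢
        exact ⟨ha.1.1, Nat.le_floor ha.2⟩
      have := Finset.card_le_card this
      rw [Nat.card_Icc, Nat.add_sub_cancel] at this
      exact (Nat.cast_le.2 this).trans (Nat.floor_le hA0)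
    · refine (Finset.sum_le_sum_of_subset_of_nonneg (Finset.filter_subset _ _)
        (fun _ _ _ => by positivity)).trans (sum_Icc_inv_le (by linarith))

theorem card_diff_ne_le {s M v δ : ℝ} (hs0 : 0 < s) (hs1 : s < 1) (hM : 1 ≤ M) (hδ : 0 ≤ δ) :
    (((dyad M ×ˢ dyad M).filter
      (fun p => p.1 ≠ p.2 ∧ |(p.1 : ℝ) ^ s - (p.2 : ℝ) ^ s - v| ≤ δ)).card : ℝ)
      ≤ 2 * ((|v| + δ) / (s * (2 * M) ^ (s - 1))
        + 2 * δ / (s * (1 - s) * (2 * M) ^ (s - 2)) * (1 + Real.log (2 * M))) := by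
  have h1 := card_diff_pos_le (v := v) hs0 hs1 hM hδ
  have h2 := card_diff_pos_le (v := -v) hs0 hs1 hM hδ
  rw [abs_neg] at h2
  set S1 := (dyad M ×ˢ dyad M).filter
      (fun p => p.2 < p.1 ∧ |(p.1 : ℝ) ^ s - (p.2 : ℝ) ^ s - v| ≤ δ)
  set S2 := (dyad M ×ˢ dyad M).filter
      (fun p => p.2 < p.1 ∧ |(p.1 : ℝ) ^ s - (p.2 : ℝ) ^ s - -v| ≤ δ) with hS2
  have h3 : ((dyad M ×ˢ dyad M).filter
      (fun p => p.1 ≠ p.2 ∧ |(p.1 : ℝ) ^ s - (p.2 : ℝ) ^ s - v| ≤ δ)).card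
      ≤ (S1 ∪ S2.image Prod.swap).card := by
    apply Finset.card_le_card
    rintro ⟨x, y⟩ hp
    simp only [Finset.mem_filter, Finset.mem_product] at hp
    obtain ⟨⟨hx, hy⟩, hne, hv⟩ := hp
    rcases lt_or_gt_of_ne hne with h | h
    · refine Finset.mem_union_right _ (Finset.mem_image.2 ⟨(y, x), ?_, rfl⟩)
      simp only [hS2, Finset.mem_filter, Finset.mem_product]
      refine ⟨⟨hy, hx⟩, h, ?_⟩
      rwa [show (y : ℝ) ^ s - (x : ℝ) ^ s - -v = -((x : ℝ) ^ s - (y : ℝ) ^ s - v) by ring, abs_neg]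
    · exact Finset.mem_union_left _ (Finset.mem_filter.2
        ⟨Finset.mem_product.2 ⟨hx, hy⟩, h, hv⟩)
  have h4 := (h3.trans (Finset.card_union_le _ _)).trans
    (Nat.add_le_add_left Finset.card_image_le _)
  have h5 : (((dyad M ×ˢ dyad M).filter
      (fun p => p.1 ≠ p.2 ∧ |(p.1 : ℝ) ^ s - (p.2 : ℝ) ^ s - v| ≤ δ)).card : ℝ)
      ≤ S1.card + S2.card := by exact_mod_cast h4
  linarith

theorem card_near_pairs_le {M L : ℝ} (hM : 0 ≤ M) (hL : 0 ≤ L) :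
    (((dyad M ×ˢ dyad M).filter (fun p => |(p.1 : ℝ) - p.2| ≤ L)).card : ℝ)
      ≤ 2 * M * (1 + 2 * L) := by
  refine (card_le_sum_of_fiber _ (dyad M) Prod.fst (fun _ => 1 + 2 * L) ?_ ?_).trans ?_
  · intro p hp
    exact (Finset.mem_product.1 (Finset.mem_filter.1 hp).1).1
  · intro a _
    refine (card_le_of_spaced _ (fun p : ℕ × ℕ => (p.2 : ℝ)) a L 1 one_pos hL ?_ ?_).trans
      (by rw [div_one])
    · rintro ⟨x, y⟩ hp
      simp only [Finset.mem_filter] at hp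
      rw [abs_sub_comm, ← hp.2]
      exact hp.1.2
    · rintro ⟨x, y⟩ hp ⟨x', y'⟩ hp' hne
      simp only [Finset.mem_filter] at hp hp'
      refine one_le_abs_natCast_sub fun h => hne ?_
      exact Prod.ext (hp.2.trans hp'.2.symm) h
  · rw [Finset.sum_const, nsmul_eq_mul]
    have := card_dyad_le hM
    gcongr

/-- Quadruples with close power differences whose second pair is at distance at most `L`. -/
theorem card_quadruples_le {s M₁ M₂ L δ : ℝ} (hs0 : 0 < s) (hs1 : s < 1) (hM₁ : 1 ≤ M₁)
    (hM₂ : 1 ≤ M₂) (hL : 0 ≤ L) (hδ : 0 ≤ δ) :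
    ((((dyad M₁ ×ˢ dyad M₁) ×ˢ (dyad M₂ ×ˢ dyad M₂)).filter
      (fun p => |(p.2.1 : ℝ) - p.2.2| ≤ L ∧
        |((p.1.1 : ℝ) ^ s - (p.1.2 : ℝ) ^ s) - ((p.2.1 : ℝ) ^ s - (p.2.2 : ℝ) ^ s)| ≤ δ)).card : ℝ)
      ≤ 2 * M₁ * (2 * M₂) * (1 + 2 * δ / (s * (2 * M₂) ^ (s - 1)))
        + 2 * M₂ * (1 + 2 * L) *
          (2 * ((s * M₂ ^ (s - 1) * L + δ) / (s * (2 * M₁) ^ (s - 1))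
            + 2 * δ / (s * (1 - s) * (2 * M₁) ^ (s - 2)) * (1 + Real.log (2 * M₁)))) := by
  have hM₁0 : 0 < M₁ := by linarith
  have hM₂0 : 0 < M₂ := by linarith
  have h1s : 0 < 1 - s := by linarith
  have hlog : 0 ≤ Real.log (2 * M₁) := Real.log_nonneg (by linarith)
  set P := (((dyad M₁ ×ˢ dyad M₁) ×ˢ (dyad M₂ ×ˢ dyad M₂)).filter
      (fun p => |(p.2.1 : ℝ) - p.2.2| ≤ L ∧
        |((p.1.1 : ℝ) ^ s - (p.1.2 : ℝ) ^ s) - ((p.2.1 : ℝ) ^ s - (p.2.2 : ℝ) ^ s)| ≤ δ)) with hP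
  rw [← Finset.card_filter_add_card_filter_not (s := P) (fun p => p.1.1 = p.1.2), Nat.cast_add]
  refine add_le_add ?_ ?_
  · refine (card_le_sum_of_fiber _ (dyad M₁ ×ˢ dyad M₂) (fun p => (p.1.1, p.2.1))
      (fun _ => 1 + 2 * δ / (s * (2 * M₂) ^ (s - 1))) ?_ ?_).trans ?_
    · intro p hp
      simp only [hP, Finset.mem_filter, Finset.mem_product] at hp ⊢
      exact ⟨hp.1.1.1.1, hp.1.1.2.1⟩
    · rintro ⟨a, b⟩ _
      refine card_le_of_spaced _ (fun p => (p.2.2 : ℝ) ^ s) ((b : ℝ) ^ s) δ _ (by positivity) hδ ?_ ?_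
      · rintro ⟨⟨x, x'⟩, y, y'⟩ hp
        simp only [hP, Finset.mem_filter, Finset.mem_product, Prod.mk.injEq] at hp ⊢
        obtain ⟨⟨⟨-, -, hv⟩, hxx⟩, -, hy⟩ := hp
        rw [hxx, sub_self, zero_sub, abs_neg, hy, abs_sub_comm] at hv
        exact hv
      · rintro ⟨⟨x, x'⟩, y, y'⟩ hp ⟨⟨u, u'⟩, w, w'⟩ hq hne
        simp only [hP, Finset.mem_filter, Finset.mem_product, Prod.mk.injEq] at hp hq hne ⊢
        obtain ⟨⟨⟨⟨_, _, hy'⟩, -, -⟩, hxx⟩, hx, hy⟩ := hp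
        obtain ⟨⟨⟨⟨_, _, hw'⟩, -, -⟩, huu⟩, hu, hw⟩ := hq
        have hyw : y' ≠ w' := by
          rintro rfl; apply hne; simp only [Prod.mk.injEq, and_true]; omega
        have h1 := mul_abs_sub_le_abs_rpow_sub hs0 hs1.le (hM₂0.trans (lt_of_mem_dyad hy'))
          (hM₂0.trans (lt_of_mem_dyad hw')) (le_of_mem_dyad hM₂0.le hy') (le_of_mem_dyad hM₂0.le hw')
        exact (le_mul_of_one_le_right (by positivity) (one_le_abs_natCast_sub hyw)).trans h1
    · rw [Finset.sum_const, nsmul_eq_mul, Finset.card_product, Nat.cast_mul]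
      have := card_dyad_le hM₁0.le
      have := card_dyad_le hM₂0.le
      gcongr
  · refine (card_le_sum_of_fiber _ ((dyad M₂ ×ˢ dyad M₂).filter (fun p => |(p.1 : ℝ) - p.2| ≤ L))
      Prod.snd (fun _ => (2 * ((s * M₂ ^ (s - 1) * L + δ) / (s * (2 * M₁) ^ (s - 1))
            + 2 * δ / (s * (1 - s) * (2 * M₁) ^ (s - 2)) * (1 + Real.log (2 * M₁))))) ?_ ?_).trans ?_
    · intro p hp
      simp only [hP, Finset.mem_filter, Finset.mem_product] at hp ⊢
      exact ⟨hp.1.1.2, hp.1.2.1⟩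
    · rintro ⟨y, y'⟩ hb
      simp only [Finset.mem_filter, Finset.mem_product] at hb
      have hv : |(y : ℝ) ^ s - (y' : ℝ) ^ s| ≤ s * M₂ ^ (s - 1) * L :=
        (abs_rpow_sub_le hs0 hs1.le hM₂0 (lt_of_mem_dyad hb.1.1).le
          (lt_of_mem_dyad hb.1.2).le).trans (by gcongr; exact hb.2)
      have h1 := card_diff_ne_le (v := (y : ℝ) ^ s - (y' : ℝ) ^ s) hs0 hs1 hM₁ hδ
      refine le_trans ?_ (h1.trans ?_)
      · rw [Nat.cast_le]
        apply Finset.card_le_card_of_injOn Prod.fst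
        · rintro ⟨⟨x, x'⟩, w, w'⟩ hp
          simp only [hP, Finset.coe_filter, Set.mem_ofPred_eq, Finset.mem_filter,
            Finset.mem_product, Prod.mk.injEq] at hp ⊢
          obtain ⟨⟨⟨⟨hx, _⟩, _, h⟩, hne⟩, rfl, rfl⟩ := hp
          exact ⟨hx, hne, h⟩
        · rintro ⟨x, w⟩ hp ⟨x', w'⟩ hp' h
          simp only [Finset.coe_filter, Set.mem_ofPred_eq] at hp hp' h
          rw [h, hp.2, hp'.2]
      · gcongr
    · rw [Finset.sum_const, nsmul_eq_mul]
      have := card_near_pairs_le (M := M₂) hM₂0.le hL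
      gcongr

theorem Bcount_le_blocks {α β M₁ M₂ H Δ : ℝ} (hα0 : 0 < α) (hα1 : α < 1) (hβ0 : 0 < β)
    (hM₁ : 1 ≤ M₁) (hM₂ : 1 ≤ M₂) (hH : 1 ≤ H) (hΔ : 0 < Δ) {L : ℕ} (hL : 0 < L) :
    (Bcount α β M₁ M₂ H Δ : ℝ) ≤ 3 * (2 * H * (2 * M₂ / L + 1) * (2 * H *
      (2 * M₁ * (2 * M₂) * (1 + 2 * (Δ / H ^ β) / (α * (2 * M₂) ^ (α - 1)))
        + 2 * M₂ * (1 + 2 * (L : ℝ)) *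
          (2 * ((α * M₂ ^ (α - 1) * L + Δ / H ^ β) / (α * (2 * M₁) ^ (α - 1))
            + 2 * (Δ / H ^ β) / (α * (1 - α) * (2 * M₁) ^ (α - 2)) *
              (1 + Real.log (2 * M₁))))))) := by
  have hH0 : 0 < H := by linarith
  have hM₂0 : 0 < M₂ := by linarith
  have hL' : (0 : ℝ) < L := by exact_mod_cast hL
  have hδ : 0 ≤ Δ / H ^ β := by positivity
  have hquad := card_quadruples_le (L := L) hα0 hα1 hM₁ hM₂ hL'.le hδ
  set W := (2 * M₁ * (2 * M₂) * (1 + 2 * (Δ / H ^ β) / (α * (2 * M₂) ^ (α - 1)))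
        + 2 * M₂ * (1 + 2 * (L : ℝ)) *
          (2 * ((α * M₂ ^ (α - 1) * L + Δ / H ^ β) / (α * (2 * M₁) ^ (α - 1))
            + 2 * (Δ / H ^ β) / (α * (1 - α) * (2 * M₁) ^ (α - 2)) *
              (1 + Real.log (2 * M₁)))))
  set Q := ((dyad M₁ ×ˢ dyad M₁) ×ˢ (dyad M₂ ×ˢ dyad M₂)).filter
      (fun p => |(p.2.1 : ℝ) - p.2.2| ≤ L ∧
        |((p.1.1 : ℝ) ^ α - (p.1.2 : ℝ) ^ α) - ((p.2.1 : ℝ) ^ α - (p.2.2 : ℝ) ^ α)|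
          ≤ Δ / H ^ β) with hQ
  set X := dyad H ×ˢ (dyad M₁ ×ˢ dyad M₂)
  set f : ℕ × ℕ × ℕ → ℝ := fun x => ((x.2.1 : ℝ) ^ α - (x.2.2 : ℝ) ^ α) * (x.1 : ℝ) ^ β with hf
  set cl : ℕ × ℕ × ℕ → ℕ × ℕ := fun x => (x.1, x.2.2 / L) with hcl
  set K := dyad H ×ˢ Finset.range (⌊2 * M₂⌋₊ / L + 1)
  have hK : ∀ x ∈ X, cl x ∈ K := by
    rintro ⟨h, m₁, m₂⟩ hx
    simp only [X, Finset.mem_product] at hx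
    refine Finset.mem_product.2 ⟨hx.1, Finset.mem_range.2 (Nat.lt_succ_of_le ?_)⟩
    exact Nat.div_le_div_right (Finset.mem_Ioc.1 hx.2.2).2
  have h1 : Bcount α β M₁ M₂ H Δ ≤ ((X ×ˢ X).filter (fun p => |f p.1 - f p.2| ≤ Δ)).card := by
    apply Finset.card_le_card_of_injOn
      (fun t : ℕ × ℕ × ℕ × ℕ × ℕ × ℕ =>
        ((t.2.2.2.2.1, t.1, t.2.2.1), (t.2.2.2.2.2, t.2.1, t.2.2.2.1)))
    · rintro ⟨a, b, c, d, e, g⟩ ht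
      simp only [Finset.coe_filter, Set.mem_ofPred_eq, Finset.mem_product, X, hf] at ht ⊢
      tauto
    · rintro ⟨a, b, c, d, e, g⟩ - ⟨a', b', c', d', e', g'⟩ - h
      simp only [Prod.mk.injEq] at h ⊢
      tauto
  have h2 : ((X ×ˢ X).filter (fun p => cl p.1 = cl p.2 ∧ |f p.1 - f p.2| ≤ Δ)).card
      ≤ (dyad H ×ˢ Q).card := by
    apply Finset.card_le_card_of_injOn
      (fun p : (ℕ × ℕ × ℕ) × (ℕ × ℕ × ℕ) =>
        (p.1.1, ((p.1.2.1, p.2.2.1), (p.1.2.2, p.2.2.2))))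
    · rintro ⟨⟨h, a, c⟩, ⟨h', b, d⟩⟩ ht
      simp only [Finset.coe_filter, Set.mem_ofPred_eq, Finset.mem_product, X, hf, hcl,
        Prod.mk.injEq, Finset.coe_product, Set.mem_prod, Finset.mem_coe, hQ] at ht ⊢
      obtain ⟨⟨⟨hh, ha, hc⟩, -, hb, hd⟩, ⟨rfl, hcd⟩, hle⟩ := ht
      refine ⟨hh, ⟨⟨ha, hb⟩, hc, hd⟩, ?_, ?_⟩
      · have e1 := Nat.div_add_mod c L
        have e2 := Nat.div_add_mod d L
        have e3 := Nat.mod_lt c hL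
        have e4 := Nat.mod_lt d hL
        rw [hcd] at e1
        have e5 : c ≤ d + L := by omega
        have e6 : d ≤ c + L := by omega
        have e5' : (c : ℝ) ≤ d + L := by exact_mod_cast e5
        have e6' : (d : ℝ) ≤ c + L := by exact_mod_cast e6
        rw [abs_le]; constructor <;> linarith
      · have hhH := lt_of_mem_dyad hh
        rw [← sub_mul, abs_mul, abs_of_nonneg (by positivity : (0 : ℝ) ≤ (h : ℝ) ^ β)] at hle
        rw [le_div_iff₀ (by positivity)]
        refine le_trans ?_ hle
        rw [show ((a : ℝ) ^ α - (b : ℝ) ^ α - ((c : ℝ) ^ α - (d : ℝ) ^ α))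
          = ((a : ℝ) ^ α - (c : ℝ) ^ α - ((b : ℝ) ^ α - (d : ℝ) ^ α)) by ring]
        gcongr
    · rintro ⟨⟨h, a, c⟩, ⟨h', b, d⟩⟩ hp ⟨⟨k, u, v⟩, ⟨k', w, z⟩⟩ hq he
      simp only [Finset.coe_filter, Set.mem_ofPred_eq, hcl, Prod.mk.injEq] at hp hq he ⊢
      have := hp.2.1.1
      have := hq.2.1.1
      omega
  have h3 := card_close_pairs_le X f cl K hK Δ hΔ
  have h4 : Bcount α β M₁ M₂ H Δ ≤ 3 * (K.card * ((dyad H).card * Q.card)) := by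
    rw [Finset.card_product] at h2
    exact h1.trans (h3.trans (by gcongr))
  have h5 : (K.card : ℝ) ≤ 2 * H * (2 * M₂ / L + 1) := by
    rw [Finset.card_product, Finset.card_range]
    push_cast
    have := card_dyad_le hH0.le
    gcongr
    exact Nat.cast_div_le.trans (by gcongr; exact Nat.floor_le (by linarith))
  calc (Bcount α β M₁ M₂ H Δ : ℝ) ≤ 3 * (K.card * ((dyad H).card * Q.card)) := by
        exact_mod_cast h4
    _ ≤ _ := by
        have := card_dyad_le hH0.le
        gcongr

theorem div_mul_rpow_neg_le {s x t y c : ℝ} (hx : 0 < x) (hs : 0 < s) (hy : 0 ≤ y)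
    (hc : 2 ^ t ≤ c) : y / (s * (2 * x) ^ (-t)) ≤ c * (y * x ^ t / s) := by
  rw [Real.rpow_neg (by positivity), Real.mul_rpow (by norm_num) hx.le]
  have : y / (s * (2 ^ t * x ^ t)⁻¹) = 2 ^ t * (y * x ^ t / s) := by
    field_simp
  rw [this]
  gcongr

theorem small_H_algebra {H M₁ M₂ r δ A α l : ℝ} (hα0 : 0 < α) (hα1 : α < 1)
    (hM₁ : 1 ≤ M₁) (hr1 : 1 ≤ r) (hr2 : M₂ = r ^ 2) (hδ : 0 ≤ δ) (hA : 0 < A) (hl : 1 ≤ l) :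
    3 * (2 * H * (3 * r) * (2 * H *
      (2 * M₁ * (2 * M₂) * (1 + 2 * (2 * δ * A / α))
        + 2 * M₂ * (6 * r) *
          (2 * (4 * r * (M₁ / M₂) + 2 * (δ * A / α)
            + 4 * (2 * δ * (M₁ * A) / (α * (1 - α))) * l)))))
      ≤ 36 * (100 + 256 / (α * (1 - α))) *
      (H ^ 2 * (M₁ * (M₂ * r) + δ * (M₁ * A * M₂ ^ 2)) * l) := by
  have h1α : 0 < 1 - α := by linarith
  have hM₂0 : 0 < M₂ := by rw [hr2]; positivity
  have hrM : r ≤ M₂ := by rw [hr2]; nlinarith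
  set z := (1 : ℝ) / (α * (1 - α)) with hz
  have hz0 : 0 < z := by positivity
  have hz1 : 1 / α ≤ z := by
    rw [hz]
    apply one_div_le_one_div_of_le (by positivity)
    nlinarith
  have hz1' : 0 < 1 / α := by positivity
  have c1 : M₁ * (M₂ * r) ≤ M₁ * (M₂ * r) * l :=
    le_mul_of_one_le_right (by positivity) hl
  have c2 : M₁ * M₂ * r * δ * A * (1 / α) ≤ δ * (M₁ * A * M₂ ^ 2) * l * z := by
    calc M₁ * M₂ * r * δ * A * (1 / α) ≤ M₁ * M₂ * M₂ * δ * A * z := by gcongr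
      _ ≤ M₁ * M₂ * M₂ * δ * A * z * l := le_mul_of_one_le_right (by positivity) hl
      _ = _ := by ring
  have c3 : M₂ * M₂ * δ * A * (1 / α) ≤ δ * (M₁ * A * M₂ ^ 2) * l * z := by
    calc M₂ * M₂ * δ * A * (1 / α) ≤ M₂ * M₂ * δ * A * z := by gcongr
      _ ≤ M₂ * M₂ * δ * A * z * (M₁ * l) :=
        le_mul_of_one_le_right (by positivity) (by nlinarith)
      _ = _ := by ring
  have d1 : 0 ≤ δ * (M₁ * A * M₂ ^ 2) * l := by positivity
  have d2 : 0 ≤ z * (M₁ * (M₂ * r) * l) := by positivity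
  calc _ = 36 * H ^ 2 * (4 * (M₁ * (M₂ * r)) + 96 * (M₁ * (r ^ 2 * r))
          + 16 * (M₁ * M₂ * r * δ * A * (1 / α)) + 48 * (M₂ * r ^ 2 * δ * A * (1 / α))
          + 192 * (δ * (M₁ * A * M₂ * r ^ 2) * l * z)) := by
        rw [hz]
        field_simp
        ring
    _ = 36 * H ^ 2 * (100 * (M₁ * (M₂ * r))
          + 16 * (M₁ * M₂ * r * δ * A * (1 / α)) + 48 * (M₂ * M₂ * δ * A * (1 / α))
          + 192 * (δ * (M₁ * A * M₂ ^ 2) * l * z)) := by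
        rw [← hr2]; ring
    _ ≤ 36 * H ^ 2 * (100 * (M₁ * (M₂ * r) * l) + 256 * (δ * (M₁ * A * M₂ ^ 2) * l * z)
          + 100 * (δ * (M₁ * A * M₂ ^ 2) * l) + 256 * (z * (M₁ * (M₂ * r) * l))) := by
        gcongr 36 * H ^ 2 * ?_
        linarith
    _ = _ := by
        rw [show 256 / (α * (1 - α)) = 256 * z by rw [hz]; ring]
        ring

theorem Bcount_le_of_small_H {α β M₁ M₂ H Δ : ℝ} (hα0 : 0 < α) (hα1 : α < 1) (hβ0 : 0 < β)
    (hM₂ : 1 ≤ M₂) (hM : M₂ ≤ M₁) (hH : 1 ≤ H) (hΔ : 0 < Δ) :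
    (Bcount α β M₁ M₂ H Δ : ℝ) ≤ 36 * (100 + 256 / (α * (1 - α))) *
      (H ^ 2 * (M₁ * (M₂ * √M₂) + Δ / H ^ β * (M₁ * M₁ ^ (1 - α) * M₂ ^ 2)) *
        (1 + Real.log (2 * M₁))) := by
  have hM₁ : 1 ≤ M₁ := hM₂.trans hM
  have hM₁0 : 0 < M₁ := by linarith
  have hM₂0 : 0 < M₂ := by linarith
  have hH0 : 0 < H := by linarith
  have h1α : 0 < 1 - α := by linarith
  set r := √M₂ with hr
  have hr1 : 1 ≤ r := Real.one_le_sqrt.2 hM₂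
  have hr2 : M₂ = r ^ 2 := (Real.sq_sqrt hM₂0.le).symm
  have hLpos : 0 < ⌈r⌉₊ := Nat.ceil_pos.2 (by linarith)
  have main := Bcount_le_blocks hα0 hα1 hβ0 hM₁ hM₂ hH hΔ hLpos
  set L : ℝ := (⌈r⌉₊ : ℝ)
  have hL1 : r ≤ L := Nat.le_ceil r
  have hL2 : L ≤ 2 * r := by
    have := Nat.ceil_lt_add_one (by linarith : 0 ≤ r)
    simp only [L]; linarith
  have hL0 : 0 < L := by linarith
  set l := 1 + Real.log (2 * M₁) with hl
  have hl1 : 1 ≤ l := by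
    have := Real.log_nonneg (by linarith : 1 ≤ 2 * M₁)
    linarith
  set δ := Δ / H ^ β
  have hδ : 0 ≤ δ := by positivity
  set A₁ := M₁ ^ (1 - α) with hA₁
  set A₂ := M₂ ^ (1 - α) with hA₂
  have hA₁0 : 0 < A₁ := by positivity
  have hA₂0 : 0 < A₂ := by positivity
  have hA : A₂ ≤ A₁ := by rw [hA₁, hA₂]; gcongr
  have hratio : A₁ / A₂ ≤ M₁ / M₂ := by
    rw [hA₁, hA₂, ← Real.div_rpow hM₁0.le hM₂0.le]
    exact Real.rpow_le_self_of_one_le ((one_le_div hM₂0).2 hM) (by linarith)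
  have two1 : (2 : ℝ) ^ (1 - α) ≤ 2 := Real.rpow_le_self_of_one_le (by norm_num) (by linarith)
  have two2 : (2 : ℝ) ^ (2 - α) ≤ 4 := by
    calc (2 : ℝ) ^ (2 - α) ≤ 2 ^ (2 : ℝ) := Real.rpow_le_rpow_of_exponent_le (by norm_num)
          (by linarith)
      _ = 4 := by norm_num
  have b1 : 2 * δ / (α * (2 * M₂) ^ (α - 1)) ≤ 2 * (2 * δ * A₁ / α) := by
    rw [show α - 1 = -(1 - α) by ring]
    refine (div_mul_rpow_neg_le hM₂0 hα0 (by positivity) two1).trans ?_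
    gcongr
  have b2 : (α * M₂ ^ (α - 1) * L + δ) / (α * (2 * M₁) ^ (α - 1))
      ≤ 4 * r * (M₁ / M₂) + 2 * (δ * A₁ / α) := by
    rw [show α - 1 = -(1 - α) by ring]
    refine (div_mul_rpow_neg_le hM₁0 hα0 (by positivity) two1).trans ?_
    rw [Real.rpow_neg hM₂0.le, ← hA₁, ← hA₂]
    calc 2 * ((α * A₂⁻¹ * L + δ) * A₁ / α) = 2 * L * (A₁ / A₂) + 2 * (δ * A₁ / α) := by
          field_simp
      _ ≤ 2 * (2 * r) * (M₁ / M₂) + 2 * (δ * A₁ / α) := by gcongr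
      _ = _ := by ring
  have b3 : 2 * δ / (α * (1 - α) * (2 * M₁) ^ (α - 2))
      ≤ 4 * (2 * δ * (M₁ * A₁) / (α * (1 - α))) := by
    rw [show α - 2 = -(2 - α) by ring]
    refine (div_mul_rpow_neg_le hM₁0 (by positivity) (by positivity) two2).trans ?_
    rw [show (2 : ℝ) - α = 1 + (1 - α) by ring, Real.rpow_add hM₁0, Real.rpow_one]
  have b4 : 2 * M₂ / L + 1 ≤ 3 * r := by
    have : 2 * M₂ / L ≤ 2 * r := by
      rw [div_le_iff₀ hL0, hr2]
      nlinarith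
    linarith
  have b5 : 1 + 2 * L ≤ 6 * r := by linarith
  refine main.trans ?_
  refine le_trans (b := 3 * (2 * H * (3 * r) * (2 * H *
      (2 * M₁ * (2 * M₂) * (1 + 2 * (2 * δ * A₁ / α))
        + 2 * M₂ * (6 * r) *
          (2 * (4 * r * (M₁ / M₂) + 2 * (δ * A₁ / α)
            + 4 * (2 * δ * (M₁ * A₁) / (α * (1 - α))) * l)))))) ?_
    (small_H_algebra hα0 hα1 hM₁ hr1 hr2 hδ hA₁0 hl1)
  gcongr

theorem card_dyad_filter_dvd_le {H : ℝ} (hH : 0 ≤ H) {g : ℕ} (hg : 0 < g) :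
    (((dyad H).filter (fun h => g ∣ h)).card : ℝ) ≤ 2 * H / g := by
  have h1 : ((dyad H).filter (fun h => g ∣ h)).card ≤ ⌊2 * H⌋₊ / g := by
    rw [← Nat.Ioc_filter_dvd_card_eq_div]
    exact Finset.card_le_card
      (Finset.filter_subset_filter _ (Finset.Ioc_subset_Ioc_left (Nat.zero_le _)))
  refine (Nat.cast_le.2 h1).trans (Nat.cast_div_le.trans ?_)
  gcongr
  exact Nat.floor_le (by linarith)

theorem card_large_gcd_le {H : ℝ} (hH : 0 ≤ H) (n : ℕ) :
    (((dyad H ×ˢ dyad H).filter (fun p => n < Nat.gcd p.1 p.2)).card : ℝ)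
      ≤ 8 * H ^ 2 / (n + 1) := by
  refine (card_le_sum_of_fiber _ (Finset.Ioo n (⌊2 * H⌋₊ + 1)) (fun p => Nat.gcd p.1 p.2)
    (fun g => 4 * H ^ 2 * ((g : ℝ) ^ 2)⁻¹) ?_ ?_).trans ?_
  · rintro ⟨x, y⟩ hp
    simp only [Finset.mem_filter, Finset.mem_product, Finset.mem_Ioo, Finset.mem_Ioc] at hp ⊢
    have := Nat.gcd_le_left y (by omega : 0 < x)
    omega
  · intro g hg
    have hg0 : 0 < g := by have := Finset.mem_Ioo.1 hg; omega
    have h1 : (((dyad H ×ˢ dyad H).filter (fun p => n < Nat.gcd p.1 p.2)).filter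
        (fun p => Nat.gcd p.1 p.2 = g)).card
        ≤ ((dyad H).filter (fun h => g ∣ h) ×ˢ (dyad H).filter (fun h => g ∣ h)).card := by
      apply Finset.card_le_card
      rintro ⟨x, y⟩ hp
      simp only [Finset.mem_filter, Finset.mem_product] at hp ⊢
      exact ⟨⟨hp.1.1.1, hp.2 ▸ Nat.gcd_dvd_left x y⟩, hp.1.1.2, hp.2 ▸ Nat.gcd_dvd_right x y⟩
    have h2 := card_dyad_filter_dvd_le hH hg0
    rw [Finset.card_product] at h1
    calc _ ≤ (((dyad H).filter (fun h => g ∣ h)).card : ℝ)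
          * ((dyad H).filter (fun h => g ∣ h)).card := by exact_mod_cast h1
      _ ≤ (2 * H / g) * (2 * H / g) := by gcongr
      _ = _ := by field_simp; ring
  · rw [← Finset.mul_sum]
    calc _ ≤ 4 * H ^ 2 * (2 / ((n : ℝ) + 1)) := by
          gcongr
          exact sum_Ioo_inv_sq_le n _
      _ = _ := by ring

theorem sq_le_abs_cross_mul_sub {g x y x' y' : ℕ} (hx : Nat.gcd x y = g)
    (hx' : Nat.gcd x' y' = g) (hg : 0 < g) (hne : (x, y) ≠ (x', y')) :
    ((g : ℝ)) ^ 2 ≤ |(x : ℝ) * y' - x' * y| := by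
  have hneq : x * y' ≠ x' * y := by
    intro h
    apply hne
    have e1 : x = x' := by
      have h1 : Nat.gcd (x * x') (x * y') = x * g := by rw [Nat.gcd_mul_left, hx']
      have h2 : Nat.gcd (x' * x) (x' * y) = x' * g := by rw [Nat.gcd_mul_left, hx]
      rw [h, mul_comm x x', h2] at h1
      exact (Nat.eq_of_mul_eq_mul_right hg h1).symm
    have e2 : y = y' := by
      have h1 : Nat.gcd (y * x') (y * y') = y * g := by rw [Nat.gcd_mul_left, hx']
      have h2 : Nat.gcd (y' * x) (y' * y) = y' * g := by rw [Nat.gcd_mul_left, hx]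
      rw [mul_comm y' x, h, mul_comm x' y, mul_comm y' y, h1] at h2
      exact Nat.eq_of_mul_eq_mul_right hg h2
    rw [e1, e2]
  have d1 : (g : ℤ) ^ 2 ∣ (x : ℤ) * y' - x' * y := by
    have a1 : (g : ℤ) ∣ x := by exact_mod_cast hx ▸ Nat.gcd_dvd_left x y
    have a2 : (g : ℤ) ∣ y := by exact_mod_cast hx ▸ Nat.gcd_dvd_right x y
    have a3 : (g : ℤ) ∣ x' := by exact_mod_cast hx' ▸ Nat.gcd_dvd_left x' y'
    have a4 : (g : ℤ) ∣ y' := by exact_mod_cast hx' ▸ Nat.gcd_dvd_right x' y'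
    rw [sq]
    exact dvd_sub (mul_dvd_mul a1 a4) (mul_dvd_mul a3 a2)
  have hne0 : (x : ℤ) * y' - x' * y ≠ 0 := by
    rw [sub_ne_zero]; exact_mod_cast hneq
  have := Int.le_of_dvd (abs_pos.2 hne0) ((dvd_abs _ _).2 d1)
  exact_mod_cast this

/-- Few pairs `(h, k)` with small gcd make `a * h ^ β` close to `b * k ^ β`. -/
theorem card_small_gcd_close_le {β H Δ a : ℝ} (b : ℝ) (hβ0 : 0 < β) (hβ1 : β < 1) (hH : 1 ≤ H)
    (hΔ : 0 < Δ) (ha : a ≠ 0) (n : ℕ) :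
    (((dyad H ×ˢ dyad H).filter (fun p => Nat.gcd p.1 p.2 ≤ n ∧
      |a * (p.1 : ℝ) ^ β - b * (p.2 : ℝ) ^ β| ≤ Δ)).card : ℝ)
      ≤ n + 32 / β * (H ^ 2 * (Δ / H ^ β)) * |a|⁻¹ := by
  have hH0 : 0 < H := by linarith
  have ha0 : 0 < |a| := abs_pos.2 ha
  set η := Δ / H ^ β * |a|⁻¹ with hη
  have hη0 : 0 ≤ η := by positivity
  set c := β * 2 ^ (β - 1) / (4 * H ^ 2) with hc
  have hc0 : 0 < c := by positivity
  refine (card_le_sum_of_fiber _ (Finset.Ioo 0 (n + 1)) (fun p => Nat.gcd p.1 p.2)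
    (fun g => 1 + 2 * η / c * ((g : ℝ) ^ 2)⁻¹) ?_ ?_).trans ?_
  · rintro ⟨x, y⟩ hp
    simp only [Finset.mem_filter, Finset.mem_product, Finset.mem_Ioo, Finset.mem_Ioc] at hp ⊢
    have := Nat.gcd_pos_of_pos_left y (by omega : 0 < x)
    omega
  · intro g hg
    have hg0 : 0 < g := (Finset.mem_Ioo.1 hg).1
    have hg0' : (0 : ℝ) < g := by exact_mod_cast hg0
    refine (card_le_of_spaced _ (fun p : ℕ × ℕ => ((p.1 : ℝ) / p.2) ^ β) (b / a) η
      (c * (g : ℝ) ^ 2) (by positivity) hη0 ?_ ?_).trans (le_of_eq ?_)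
    · rintro ⟨x, y⟩ hp
      simp only [Finset.mem_filter, Finset.mem_product] at hp
      obtain ⟨⟨⟨hx, hy⟩, -, hle⟩, -⟩ := hp
      have hy0 : (0 : ℝ) < y := hH0.trans (lt_of_mem_dyad hy)
      have hyH : H ^ β ≤ (y : ℝ) ^ β := by
        have := (lt_of_mem_dyad hy).le
        gcongr
      have hyβ : 0 < (y : ℝ) ^ β := by positivity
      simp only
      rw [Real.div_rpow (by positivity) hy0.le]
      have e : (x : ℝ) ^ β / (y : ℝ) ^ β - b / a
          = (a * (x : ℝ) ^ β - b * (y : ℝ) ^ β) / (a * (y : ℝ) ^ β) := by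
        field_simp
      rw [e, abs_div, abs_mul, abs_of_pos hyβ, hη, ← div_eq_mul_inv, div_div, mul_comm |a|]
      gcongr
    · rintro ⟨x, y⟩ hp ⟨x', y'⟩ hp' hne
      simp only [Finset.mem_filter, Finset.mem_product] at hp hp'
      obtain ⟨⟨⟨hx, hy⟩, -⟩, hgcd⟩ := hp
      obtain ⟨⟨⟨hx', hy'⟩, -⟩, hgcd'⟩ := hp'
      have px := hH0.trans (lt_of_mem_dyad hx)
      have py := hH0.trans (lt_of_mem_dyad hy)
      have px' := hH0.trans (lt_of_mem_dyad hx')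
      have py' := hH0.trans (lt_of_mem_dyad hy')
      have q1 : (x : ℝ) / y ≤ 2 := by
        rw [div_le_iff₀ py]
        linarith [le_of_mem_dyad hH0.le hx, lt_of_mem_dyad hy]
      have q2 : (x' : ℝ) / y' ≤ 2 := by
        rw [div_le_iff₀ py']
        linarith [le_of_mem_dyad hH0.le hx', lt_of_mem_dyad hy']
      have h1 := mul_abs_sub_le_abs_rpow_sub hβ0 hβ1.le (div_pos px py) (div_pos px' py') q1 q2
      refine le_trans ?_ h1
      have h2 := sq_le_abs_cross_mul_sub hgcd hgcd' hg0 hne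
      have h3 : (g : ℝ) ^ 2 / (4 * H ^ 2) ≤ |(x : ℝ) / y - x' / y'| := by
        rw [div_sub_div _ _ py.ne' py'.ne', abs_div, abs_of_pos (mul_pos py py'), mul_comm (y : ℝ) x']
        have h4 : (y : ℝ) * y' ≤ 4 * H ^ 2 := by
          calc (y : ℝ) * y' ≤ (2 * H) * (2 * H) :=
                mul_le_mul (le_of_mem_dyad hH0.le hy) (le_of_mem_dyad hH0.le hy') py'.le
                  (by positivity)
            _ = _ := by ring
        gcongr
      calc c * (g : ℝ) ^ 2 = β * 2 ^ (β - 1) * ((g : ℝ) ^ 2 / (4 * H ^ 2)) := by rw [hc]; ring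
        _ ≤ _ := by gcongr
    · field_simp
  · rw [Finset.sum_add_distrib, ← Finset.mul_sum, Finset.sum_const, Nat.card_Ioo, nsmul_eq_mul,
      mul_one]
    have h1 : (∑ i ∈ Finset.Ioo 0 (n + 1), ((i : ℝ) ^ 2)⁻¹) ≤ 2 := by
      simpa using sum_Ioo_inv_sq_le (α := ℝ) 0 (n + 1)
    have h2 : 1 / c ≤ 8 * H ^ 2 / β := by
      have := div_mul_rpow_neg_le (s := β / (4 * H ^ 2)) (x := 1) (t := 1 - β) (y := 1) (c := 2)
        one_pos (by positivity) zero_le_one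
        (Real.rpow_le_self_of_one_le (by norm_num) (by linarith))
      rw [Real.one_rpow, mul_one, neg_sub, mul_one] at this
      calc 1 / c = 1 / (β / (4 * H ^ 2) * 2 ^ (β - 1)) := by rw [hc]; congr 1; ring
        _ ≤ _ := this
        _ = _ := by field_simp; norm_num
    have h3 : ((n + 1 - 0 - 1 : ℕ) : ℝ) = n := by simp
    rw [h3]
    refine add_le_add le_rfl ?_
    calc 2 * η / c * _ ≤ 2 * η / c * 2 := by gcongr
      _ = 4 * η * (1 / c) := by ring
      _ ≤ 4 * η * (8 * H ^ 2 / β) := by gcongr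
      _ = _ := by rw [hη]; ring

theorem sum_inv_abs_sub_le {M : ℝ} (hM : 1 ≤ M) {n : ℕ} (hn : (n : ℝ) ≤ 2 * M) :
    ∑ m ∈ (dyad M).filter (fun m => m ≠ n), |(m : ℝ) - n|⁻¹ ≤ 2 * (1 + Real.log (2 * M)) := by
  have hn' : n ≤ ⌊2 * M⌋₊ := Nat.le_floor hn
  have hlog := sum_Icc_inv_le (M := 2 * M) (by linarith)
  have aux : ∀ (S : Finset ℕ) (g : ℕ → ℕ), Set.InjOn g S →
      (∀ m ∈ S, g m ∈ Finset.Icc 1 ⌊2 * M⌋₊ ∧ ((g m : ℕ) : ℝ) = |(m : ℝ) - n|) →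
      ∑ m ∈ S, |(m : ℝ) - n|⁻¹ ≤ 1 + Real.log (2 * M) := by
    intro S g hg hS
    refine le_trans ?_ hlog
    rw [Finset.sum_congr rfl fun m hm => by rw [← (hS m hm).2],
      ← Finset.sum_image (f := fun d : ℕ => ((d : ℝ))⁻¹) hg]
    refine Finset.sum_le_sum_of_subset_of_nonneg ?_ fun _ _ _ => by positivity
    intro d hd
    obtain ⟨m, hm, rfl⟩ := Finset.mem_image.1 hd
    exact (hS m hm).1
  rw [← Finset.sum_filter_add_sum_filter_not _ (fun m => n < m), two_mul]
  refine add_le_add (aux _ (fun m => m - n) ?_ ?_) (aux _ (fun m => n - m) ?_ ?_)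
  · intro x hx y hy h
    simp only [Finset.coe_filter, Set.mem_ofPred_eq, Finset.mem_filter] at hx hy h
    omega
  · intro m hm
    simp only [Finset.mem_filter, Finset.mem_Ioc, Finset.mem_Icc] at hm ⊢
    refine ⟨by omega, ?_⟩
    rw [Nat.cast_sub hm.2.le, abs_of_pos]
    exact sub_pos.2 (Nat.cast_lt.2 hm.2)
  · intro x hx y hy h
    simp only [Finset.coe_filter, Set.mem_ofPred_eq, Finset.mem_filter] at hx hy h
    omega
  · intro m hm
    simp only [Finset.mem_filter, Finset.mem_Ioc, Finset.mem_Icc] at hm ⊢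
    have hlt : m < n := by omega
    refine ⟨by omega, ?_⟩
    rw [Nat.cast_sub hlt.le, abs_of_neg (sub_neg.2 (Nat.cast_lt.2 hlt)), neg_sub]

theorem sum_inv_abs_rpow_sub_le {s M₁ M₂ : ℝ} (hs0 : 0 < s) (hs1 : s < 1) (hM₂ : 1 ≤ M₂)
    (hM : M₂ ≤ M₁) :
    ∑ p ∈ (dyad M₁ ×ˢ dyad M₂).filter (fun p => p.1 ≠ p.2), |(p.1 : ℝ) ^ s - (p.2 : ℝ) ^ s|⁻¹
      ≤ 8 / s * (M₁ ^ (1 - s) * M₂) * (1 + Real.log (2 * M₁)) := by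
  have hM₁ : 1 ≤ M₁ := hM₂.trans hM
  have hM₁0 : 0 < M₁ := by linarith
  have hM₂0 : 0 < M₂ := by linarith
  have hlog : 0 ≤ Real.log (2 * M₁) := Real.log_nonneg (by linarith)
  have hc : 1 / (s * (2 * M₁) ^ (s - 1)) ≤ 2 * (1 * M₁ ^ (1 - s) / s) := by
    rw [show s - 1 = -(1 - s) by ring]
    exact div_mul_rpow_neg_le hM₁0 hs0 zero_le_one
      (Real.rpow_le_self_of_one_le (by norm_num) (by linarith))
  calc _ ≤ ∑ p ∈ (dyad M₁ ×ˢ dyad M₂).filter (fun p => p.1 ≠ p.2),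
        2 * (1 * M₁ ^ (1 - s) / s) * |(p.1 : ℝ) - p.2|⁻¹ := by
        refine Finset.sum_le_sum ?_
        rintro ⟨x, y⟩ hp
        simp only [Finset.mem_filter, Finset.mem_product] at hp
        obtain ⟨⟨hx, hy⟩, hne⟩ := hp
        have h1 := mul_abs_sub_le_abs_rpow_sub hs0 hs1.le (hM₁0.trans (lt_of_mem_dyad hx))
          (hM₂0.trans (lt_of_mem_dyad hy)) (le_of_mem_dyad hM₁0.le hx)
          ((le_of_mem_dyad hM₂0.le hy).trans (by linarith))
        have h2 := one_le_abs_natCast_sub hne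
        have h3 : 0 < |(x : ℝ) - y| := by linarith
        calc |(x : ℝ) ^ s - (y : ℝ) ^ s|⁻¹ ≤ (s * (2 * M₁) ^ (s - 1) * |(x : ℝ) - y|)⁻¹ := by
              gcongr
          _ = 1 / (s * (2 * M₁) ^ (s - 1)) * |(x : ℝ) - y|⁻¹ := by rw [mul_inv, one_div]
          _ ≤ _ := by gcongr
    _ = 2 * (1 * M₁ ^ (1 - s) / s) * ∑ y ∈ dyad M₂,
          ∑ x ∈ (dyad M₁).filter (fun x => x ≠ y), |(x : ℝ) - y|⁻¹ := by
        rw [← Finset.mul_sum, Finset.sum_filter, Finset.sum_product_right]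
        simp only [Finset.sum_filter]
    _ ≤ 2 * (1 * M₁ ^ (1 - s) / s) * ∑ y ∈ dyad M₂, 2 * (1 + Real.log (2 * M₁)) := by
        gcongr with y hy
        exact sum_inv_abs_sub_le hM₁ ((le_of_mem_dyad hM₂0.le hy).trans (by linarith))
    _ ≤ 2 * (1 * M₁ ^ (1 - s) / s) * (2 * M₂ * (2 * (1 + Real.log (2 * M₁)))) := by
        rw [Finset.sum_const, nsmul_eq_mul]
        have := card_dyad_le hM₂0.le
        gcongr
    _ = _ := by ring

theorem card_large_gcd_solutions_le {α β M₁ M₂ H Δ : ℝ} (hα0 : 0 < α) (hα1 : α < 1) (hβ0 : 0 < β)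
    (hM₁ : 1 ≤ M₁) (hM₂ : 1 ≤ M₂) (hH : 1 ≤ H) (hΔ : 0 < Δ) (n : ℕ) :
    (((dyad M₁ ×ˢ dyad M₁ ×ˢ dyad M₂ ×ˢ dyad M₂ ×ˢ dyad H ×ˢ dyad H).filter
      (fun t : ℕ × ℕ × ℕ × ℕ × ℕ × ℕ =>
        |((t.1 : ℝ) ^ α - (t.2.2.1 : ℝ) ^ α) * (t.2.2.2.2.1 : ℝ) ^ β -
          ((t.2.1 : ℝ) ^ α - (t.2.2.2.1 : ℝ) ^ α) * (t.2.2.2.2.2 : ℝ) ^ β| ≤ Δ ∧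
        n < Nat.gcd t.2.2.2.2.1 t.2.2.2.2.2)).card : ℝ)
      ≤ 8 * H ^ 2 / (n + 1) * (2 * M₁ * (2 * M₂ * (2 * M₂))) *
        (1 + 4 * (Δ / H ^ β * M₁ ^ (1 - α)) / α) := by
  have hM₁0 : 0 < M₁ := by linarith
  have hM₂0 : 0 < M₂ := by linarith
  have hH0 : 0 < H := by linarith
  have hδ : 0 ≤ Δ / H ^ β := by positivity
  have hγ : 2 * (Δ / H ^ β) / (α * (2 * M₁) ^ (α - 1))
      ≤ 2 * (2 * (Δ / H ^ β) * M₁ ^ (1 - α) / α) := by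
    rw [show α - 1 = -(1 - α) by ring]
    exact div_mul_rpow_neg_le hM₁0 hα0 (by positivity)
      (Real.rpow_le_self_of_one_le (by norm_num) (by linarith))
  refine (card_le_sum_of_fiber _
    ((dyad H ×ˢ dyad H).filter (fun p => n < Nat.gcd p.1 p.2) ×ˢ
      (dyad M₁ ×ˢ dyad M₂ ×ˢ dyad M₂))
    (fun t => ((t.2.2.2.2.1, t.2.2.2.2.2), (t.2.1, t.2.2.1, t.2.2.2.1)))
    (fun _ => 1 + 4 * (Δ / H ^ β * M₁ ^ (1 - α)) / α) ?_ ?_).trans ?_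
  · rintro ⟨a, b, c, d, e, g⟩ ht
    simp only [Finset.mem_filter, Finset.mem_product] at ht ⊢
    tauto
  · rintro ⟨⟨e, g⟩, b, c, d⟩ hk
    simp only [Finset.mem_filter, Finset.mem_product] at hk
    have hle : H ≤ e := (lt_of_mem_dyad hk.1.1.1).le
    have heβ : H ^ β ≤ (e : ℝ) ^ β := by gcongr
    have hHβ : 0 < H ^ β := by positivity
    have heβ0 : 0 < (e : ℝ) ^ β := hHβ.trans_le heβ
    refine (card_le_of_spaced _ (fun t : ℕ × ℕ × ℕ × ℕ × ℕ × ℕ => (t.1 : ℝ) ^ α)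
      ((c : ℝ) ^ α + ((b : ℝ) ^ α - (d : ℝ) ^ α) * (g : ℝ) ^ β / (e : ℝ) ^ β) (Δ / H ^ β)
      (α * (2 * M₁) ^ (α - 1)) (by positivity) hδ ?_ ?_).trans ?_
    · rintro ⟨a, b', c', d', e', g'⟩ ht
      simp only [Finset.mem_filter, Finset.mem_product, Prod.mk.injEq] at ht
      obtain ⟨⟨-, h1, -⟩, ⟨rfl, rfl⟩, rfl, rfl, rfl⟩ := ht
      have e1 : (a : ℝ) ^ α - ((c' : ℝ) ^ α
            + ((b' : ℝ) ^ α - (d' : ℝ) ^ α) * (g' : ℝ) ^ β / (e' : ℝ) ^ β)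
          = (((a : ℝ) ^ α - (c' : ℝ) ^ α) * (e' : ℝ) ^ β
            - ((b' : ℝ) ^ α - (d' : ℝ) ^ α) * (g' : ℝ) ^ β) / (e' : ℝ) ^ β := by
        field_simp
        ring
      simp only
      rw [e1, abs_div, abs_of_pos heβ0]
      gcongr
    · rintro ⟨a, b₁, c₁, d₁, e₁, g₁⟩ ht ⟨a', b₂, c₂, d₂, e₂, g₂⟩ ht' hne
      simp only [Finset.mem_filter, Finset.mem_product, Prod.mk.injEq] at ht ht'
      obtain ⟨⟨⟨ha, -⟩, -⟩, ⟨rfl, rfl⟩, rfl, rfl, rfl⟩ := ht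
      obtain ⟨⟨⟨ha', -⟩, -⟩, ⟨rfl, rfl⟩, rfl, rfl, rfl⟩ := ht'
      have hne' : a ≠ a' := fun h => hne (by rw [h])
      refine le_trans ?_ (mul_abs_sub_le_abs_rpow_sub hα0 hα1.le (hM₁0.trans (lt_of_mem_dyad ha))
        (hM₁0.trans (lt_of_mem_dyad ha')) (le_of_mem_dyad hM₁0.le ha)
        (le_of_mem_dyad hM₁0.le ha'))
      exact le_mul_of_one_le_right (by positivity) (one_le_abs_natCast_sub hne')
    · refine (add_le_add le_rfl hγ).trans (le_of_eq ?_)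
      ring
  · rw [Finset.sum_const, nsmul_eq_mul, Finset.card_product, Finset.card_product,
      Finset.card_product]
    push_cast
    have h1 := card_large_gcd_le hH0.le n
    have h2 := card_dyad_le hM₁0.le
    have h3 := card_dyad_le hM₂0.le
    gcongr

theorem card_small_gcd_solutions_le {α β M₁ M₂ H Δ : ℝ} (hα0 : 0 < α) (hα1 : α < 1) (hβ0 : 0 < β)
    (hβ1 : β < 1) (hM₂ : 1 ≤ M₂) (hM : M₂ ≤ M₁) (hH : 1 ≤ H) (hΔ : 0 < Δ) (n : ℕ) :
    (((dyad M₁ ×ˢ dyad M₁ ×ˢ dyad M₂ ×ˢ dyad M₂ ×ˢ dyad H ×ˢ dyad H).filter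
      (fun t : ℕ × ℕ × ℕ × ℕ × ℕ × ℕ => t.1 ≠ t.2.2.1 ∧
        |((t.1 : ℝ) ^ α - (t.2.2.1 : ℝ) ^ α) * (t.2.2.2.2.1 : ℝ) ^ β -
          ((t.2.1 : ℝ) ^ α - (t.2.2.2.1 : ℝ) ^ α) * (t.2.2.2.2.2 : ℝ) ^ β| ≤ Δ ∧
        Nat.gcd t.2.2.2.2.1 t.2.2.2.2.2 ≤ n)).card : ℝ)
      ≤ 2 * M₁ * (2 * M₂) * (2 * M₁ * (2 * M₂) * n + 32 / β * (H ^ 2 * (Δ / H ^ β)) *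
        (8 / α * (M₁ ^ (1 - α) * M₂) * (1 + Real.log (2 * M₁)))) := by
  have hM₁ : 1 ≤ M₁ := hM₂.trans hM
  have hM₁0 : 0 < M₁ := by linarith
  have hM₂0 : 0 < M₂ := by linarith
  have hH0 : 0 < H := by linarith
  set P := (dyad M₁ ×ˢ dyad M₂).filter (fun p => p.1 ≠ p.2) with hP
  refine (card_le_sum_of_fiber _ ((dyad M₁ ×ˢ dyad M₂) ×ˢ P)
    (fun t => ((t.2.1, t.2.2.2.1), (t.1, t.2.2.1)))
    (fun q => n + 32 / β * (H ^ 2 * (Δ / H ^ β)) * |(q.2.1 : ℝ) ^ α - (q.2.2 : ℝ) ^ α|⁻¹)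
    ?_ ?_).trans ?_
  · rintro ⟨a, b, c, d, e, g⟩ ht
    simp only [hP, Finset.mem_filter, Finset.mem_product] at ht ⊢
    tauto
  · rintro ⟨⟨b, d⟩, a, c⟩ hk
    simp only [hP, Finset.mem_filter, Finset.mem_product] at hk
    obtain ⟨-, ⟨ha, hc⟩, hne⟩ := hk
    have hac : (a : ℝ) ^ α - (c : ℝ) ^ α ≠ 0 := by
      rw [sub_ne_zero]
      intro h
      exact hne (Nat.cast_injective
        ((Real.rpow_left_inj (Nat.cast_nonneg a) (Nat.cast_nonneg c) hα0.ne').1 h))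
    refine le_trans ?_ (card_small_gcd_close_le ((b : ℝ) ^ α - (d : ℝ) ^ α) hβ0 hβ1 hH hΔ hac n)
    rw [Nat.cast_le]
    apply Finset.card_le_card_of_injOn
      (fun t : ℕ × ℕ × ℕ × ℕ × ℕ × ℕ => (t.2.2.2.2.1, t.2.2.2.2.2))
    · rintro ⟨a', b', c', d', e, g⟩ ht
      simp only [Finset.coe_filter, Set.mem_ofPred_eq, Finset.mem_filter, Finset.mem_product,
        Prod.mk.injEq] at ht ⊢
      obtain ⟨⟨⟨-, -, -, -, he, hg⟩, -, h1, h2⟩, ⟨rfl, rfl⟩, rfl, rfl⟩ := ht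
      exact ⟨⟨he, hg⟩, h2, h1⟩
    · rintro ⟨a₁, b₁, c₁, d₁, e₁, g₁⟩ h₁ ⟨a₂, b₂, c₂, d₂, e₂, g₂⟩ h₂ h
      simp only [Finset.coe_filter, Set.mem_ofPred_eq, Finset.mem_filter, Prod.mk.injEq]
        at h₁ h₂ h ⊢
      omega
  · have hcard : (((dyad M₁ ×ˢ dyad M₂).card : ℕ) : ℝ) ≤ 2 * M₁ * (2 * M₂) := by
      rw [Finset.card_product]
      push_cast
      have h2 := card_dyad_le hM₁0.le
      have h3 := card_dyad_le hM₂0.le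
      gcongr
    have hcardP : (P.card : ℝ) ≤ 2 * M₁ * (2 * M₂) :=
      (Nat.cast_le.2 (Finset.card_filter_le _ _)).trans hcard
    have hsum := sum_inv_abs_rpow_sub_le hα0 hα1 hM₂ hM
    have hlog : 0 ≤ Real.log (2 * M₁) := Real.log_nonneg (by linarith)
    rw [Finset.sum_product]
    dsimp only
    rw [Finset.sum_const, nsmul_eq_mul, Finset.sum_add_distrib, ← Finset.mul_sum,
      Finset.sum_const, nsmul_eq_mul]
    gcongr

theorem large_H_algebra {α β M₁ M₂ H r δ A l n : ℝ} (hα0 : 0 < α) (hβ0 : 0 < β)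
    (hβ1 : β < 1) (hr1 : 1 ≤ r) (hr : M₁ = r ^ 2) (hM₂ : 0 < M₂) (hH : M₁ ≤ H)
    (hδ : 0 ≤ δ) (hA : 0 < A) (hl : 1 ≤ l) (hn1 : n ≤ H / r) (hn2 : H / r ≤ n + 1) :
    8 * H ^ 2 / (n + 1) * (2 * M₁ * (2 * M₂ * (2 * M₂))) * (1 + 4 * (δ * A) / α)
      + 2 * M₁ * (2 * M₂) * (2 * M₁ * (2 * M₂) * n + 32 / β * (H ^ 2 * δ) *
        (8 / α * (A * M₂) * l))
      ≤ (80 + 1280 / (α * β)) * ((H * (M₁ * r * M₂ ^ 2) + H ^ 2 * δ * (M₁ * A * M₂ ^ 2)) * l) := by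
  have hr0 : 0 < r := by linarith
  have hM₁ : 0 < M₁ := by rw [hr]; positivity
  have hH0 : 0 < H := by linarith
  have hrH : r ≤ H := by nlinarith
  have k1 : 8 * H ^ 2 / (n + 1) ≤ 8 * (H * r) := by
    rw [div_le_iff₀ (lt_of_lt_of_le (by positivity) hn2)]
    calc 8 * H ^ 2 = 8 * (H * r) * (H / r) := by field_simp
      _ ≤ _ := by gcongr
  have k2 : M₁ * n ≤ H * r := by
    calc M₁ * n ≤ M₁ * (H / r) := by gcongr
      _ = _ := by rw [hr]; field_simp
  have k3 : 1 / α ≤ 1 / (α * β) := by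
    apply one_div_le_one_div_of_le (by positivity)
    nlinarith
  have k4 : 0 ≤ 1 / (α * β) := by positivity
  have k5 : 0 < 1 / α := by positivity
  set z := 1 / (α * β) with hz
  set T := H ^ 2 * δ * (M₁ * A * M₂ ^ 2) with hT
  set U := H * (M₁ * r * M₂ ^ 2) with hU
  have hT0 : 0 ≤ T := by positivity
  have hU0 : 0 ≤ U := by positivity
  have t1 : 8 * H ^ 2 / (n + 1) * (2 * M₁ * (2 * M₂ * (2 * M₂))) * (1 + 4 * (δ * A) / α)
      ≤ 64 * U + 256 * (z * T) := by
    calc _ ≤ 8 * (H * r) * (2 * M₁ * (2 * M₂ * (2 * M₂))) * (1 + 4 * (δ * A) / α) := by gcongr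
      _ = 64 * U + 256 * (1 / α * (H * r * δ * (M₁ * A * M₂ ^ 2))) := by rw [hU]; ring
      _ ≤ 64 * U + 256 * (z * (H * H * δ * (M₁ * A * M₂ ^ 2))) := by gcongr
      _ = _ := by rw [hT]; ring
  have t2 : 2 * M₁ * (2 * M₂) * (2 * M₁ * (2 * M₂) * n + 32 / β * (H ^ 2 * δ) *
        (8 / α * (A * M₂) * l)) ≤ 16 * U + 1024 * (z * T * l) := by
    calc _ = 16 * (M₁ * n * (M₁ * M₂ ^ 2)) + 1024 * (z * T * l) := by
          rw [hz, hT]; field_simp; ring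
      _ ≤ 16 * (H * r * (M₁ * M₂ ^ 2)) + 1024 * (z * T * l) := by gcongr
      _ = _ := by rw [hU]; ring
  have u1 : U ≤ U * l := le_mul_of_one_le_right hU0 hl
  have u2 : z * T ≤ z * T * l := le_mul_of_one_le_right (by positivity) hl
  have u3 : 0 ≤ T * l := by positivity
  have u4 : 0 ≤ z * (U * l) := by positivity
  rw [show 1280 / (α * β) = 1280 * z by rw [hz]; ring]
  linarith

theorem Bcount_le_of_large_H {α β M₁ M₂ H Δ : ℝ} (hα0 : 0 < α) (hα1 : α < 1) (hβ0 : 0 < β)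
    (hβ1 : β < 1) (hM₂ : 1 ≤ M₂) (hM : M₂ ≤ M₁) (hH : M₁ ≤ H) (hΔ : 0 < Δ) :
    (Bcount α β M₁ M₂ H Δ : ℝ) ≤ (80 + 1280 / (α * β)) *
      ((H * (M₁ * √M₁ * M₂ ^ 2) + H ^ 2 * (Δ / H ^ β) * (M₁ * M₁ ^ (1 - α) * M₂ ^ 2)) *
        (1 + Real.log (2 * M₁))) := by
  have hM₁ : 1 ≤ M₁ := hM₂.trans hM
  have hH1 : 1 ≤ H := hM₁.trans hH
  have hM₁0 : 0 < M₁ := by linarith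
  have hH0 : 0 < H := by linarith
  have hl : 1 ≤ 1 + Real.log (2 * M₁) := by
    have := Real.log_nonneg (by linarith : 1 ≤ 2 * M₁)
    linarith
  set n := ⌊H / √M₁⌋₊
  refine le_trans ?_ (large_H_algebra hα0 hβ0 hβ1 (Real.one_le_sqrt.2 hM₁)
    (Real.sq_sqrt hM₁0.le).symm (by linarith) hH (by positivity) (by positivity) hl
    (Nat.floor_le (by positivity) : (n : ℝ) ≤ _) (Nat.lt_floor_add_one _).le)
  refine le_trans ?_ (add_le_add
    (card_large_gcd_solutions_le hα0 hα1 hβ0 hM₁ hM₂ hH1 hΔ n)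
    (card_small_gcd_solutions_le hα0 hα1 hβ0 hβ1 hM₂ hM hH1 hΔ n))
  rw [Bcount, ← Finset.card_filter_add_card_filter_not
    (fun t : ℕ × ℕ × ℕ × ℕ × ℕ × ℕ => n < Nat.gcd t.2.2.2.2.1 t.2.2.2.2.2), Nat.cast_add]
  refine add_le_add (Nat.cast_le.2 (Finset.card_le_card fun t ht => ?_))
    (Nat.cast_le.2 (Finset.card_le_card fun t ht => ?_))
  · simp only [Finset.mem_filter] at ht ⊢
    tauto
  · simp only [Finset.mem_filter, not_lt] at ht ⊢
    tauto

theorem Bcount_le_Bcount_swap (α β M₁ M₂ H Δ : ℝ) :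
    Bcount α β M₁ M₂ H Δ ≤ Bcount α β M₂ M₁ H Δ := by
  apply Finset.card_le_card_of_injOn (fun t : ℕ × ℕ × ℕ × ℕ × ℕ × ℕ =>
    (t.2.2.1, t.2.2.2.1, t.1, t.2.1, t.2.2.2.2.1, t.2.2.2.2.2))
  · rintro ⟨a, b, c, d, e, g⟩ ht
    simp only [Finset.coe_filter, Set.mem_ofPred_eq, Finset.mem_product] at ht ⊢
    obtain ⟨h1, h2, h3, h4⟩ := ht
    refine ⟨by tauto, h2.symm, h3.symm, ?_⟩
    rw [abs_sub_comm] at h4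
    convert h4 using 2
    ring
  · rintro ⟨a, b, c, d, e, g⟩ - ⟨a', b', c', d', e', g'⟩ - h
    simp only [Prod.mk.injEq] at h ⊢
    tauto

theorem Bcount_le_mul_log {α β M₁ M₂ H Δ : ℝ} (hα0 : 0 < α) (hα1 : α < 1) (hβ0 : 0 < β)
    (hβ1 : β < 1) (hM₂ : 1 ≤ M₂) (hM : M₂ ≤ M₁) (hH : 1 ≤ H) (hΔ : 0 < Δ) :
    (Bcount α β M₁ M₂ H Δ : ℝ) ≤ (3680 + 9216 / (α * (1 - α)) + 1280 / (α * β)) *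
      ((H * √H * (M₁ * √M₁ * (M₂ * √M₂)) +
        H ^ 2 * (Δ / H ^ β) * (M₁ * M₁ ^ (1 - α) * M₂ ^ 2)) * (1 + Real.log (2 * M₁))) := by
  have hM₁ : 1 ≤ M₁ := hM₂.trans hM
  have hM₁0 : 0 < M₁ := by linarith
  have hM₂0 : 0 < M₂ := by linarith
  have hH0 : 0 < H := by linarith
  have h1α : 0 < 1 - α := by linarith
  have hl : 0 ≤ 1 + Real.log (2 * M₁) := by
    have := Real.log_nonneg (by linarith : 1 ≤ 2 * M₁)
    linarith
  rcases le_total H M₁ with h | h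
  · refine (Bcount_le_of_small_H hα0 hα1 hβ0 hM₂ hM hH hΔ).trans ?_
    have e1 : √H ≤ √M₁ := Real.sqrt_le_sqrt h
    have e2 : H ^ 2 * (M₁ * (M₂ * √M₂)) ≤ H * √H * (M₁ * √M₁ * (M₂ * √M₂)) := by
      calc H ^ 2 * (M₁ * (M₂ * √M₂)) = H * √H * (M₁ * √H * (M₂ * √M₂)) := by
            linear_combination (-(H * (M₁ * (M₂ * √M₂)))) * (Real.mul_self_sqrt hH0.le)
        _ ≤ _ := by gcongr
    rw [mul_add (H ^ 2), ← mul_assoc (H ^ 2) (Δ / H ^ β)]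
    gcongr
    have : 0 ≤ 1280 / (α * β) := by positivity
    rw [show 9216 / (α * (1 - α)) = 36 * (256 / (α * (1 - α))) by ring]
    linarith
  · refine (Bcount_le_of_large_H hα0 hα1 hβ0 hβ1 hM₂ hM h hΔ).trans ?_
    have e1 : √M₂ ≤ √H := Real.sqrt_le_sqrt (hM.trans h)
    have e2 : H * (M₁ * √M₁ * M₂ ^ 2) ≤ H * √H * (M₁ * √M₁ * (M₂ * √M₂)) := by
      calc H * (M₁ * √M₁ * M₂ ^ 2) = H * √M₂ * (M₁ * √M₁ * (M₂ * √M₂)) := by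
            linear_combination (-(H * (M₁ * √M₁ * M₂))) * (Real.mul_self_sqrt hM₂0.le)
        _ ≤ _ := by gcongr
    gcongr
    have : 0 ≤ 9216 / (α * (1 - α)) := by positivity
    linarith

theorem rpow_three_halves {x : ℝ} (hx : 0 < x) : x ^ ((3 : ℝ) / 2) = x * √x := by
  rw [show (3 : ℝ) / 2 = 1 + 1 / 2 by norm_num, Real.rpow_add hx, Real.rpow_one,
    Real.sqrt_eq_rpow]

/-- The bound for `M₂ ≤ M₁`, without the middle term. -/
theorem Bcount_le_rpow {α β ε M₁ M₂ H Δ : ℝ} (hα0 : 0 < α) (hα1 : α < 1) (hβ0 : 0 < β)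
    (hβ1 : β < 1) (hε : 0 < ε) (hM₂ : 2 ≤ M₂) (hM : M₂ ≤ M₁) (hH : 1 ≤ H) (hΔ : 0 < Δ) :
    (Bcount α β M₁ M₂ H Δ : ℝ) ≤ (3680 + 9216 / (α * (1 - α)) + 1280 / (α * β)) * (1 + 1 / ε) *
      ((M₁ * M₂) ^ ((3 : ℝ) / 2 + ε) * H ^ ((3 : ℝ) / 2)
        + (M₁ * M₂) ^ (2 - α / 2 + ε) * H ^ (2 - β) * Δ) := by
  have hM₁0 : 0 < M₁ := by linarith
  have hM₂0 : 0 < M₂ := by linarith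
  have hH0 : 0 < H := by linarith
  have h1α : 0 < 1 - α := by linarith
  have hP0 : 0 < M₁ * M₂ := by positivity
  have hP1 : 1 ≤ M₁ * M₂ := by nlinarith
  set E := (M₁ * M₂) ^ ε with hE
  have hlog : 1 + Real.log (2 * M₁) ≤ (1 + 1 / ε) * E := by
    have h1 : Real.log (2 * M₁) ≤ Real.log (M₁ * M₂) :=
      Real.log_le_log (by positivity) (by nlinarith)
    have h2 := Real.log_le_rpow_div hP0.le hε
    have h3 : 1 ≤ E := Real.one_le_rpow hP1 hε.le
    rw [← hE] at h2
    calc _ ≤ E + E / ε := by linarith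
      _ = _ := by ring
  have hmain : M₁ * M₁ ^ (1 - α) * M₂ ^ 2 ≤ (M₁ * M₂) ^ (2 - α / 2) := by
    have e1 : M₁ * M₁ ^ (1 - α) = M₁ ^ (2 - α) := by
      rw [show 2 - α = 1 + (1 - α) by ring, Real.rpow_add hM₁0, Real.rpow_one]
    have e2 : M₂ ^ 2 = M₂ ^ (2 - α / 2) * M₂ ^ (α / 2) := by
      rw [← Real.rpow_add hM₂0, sub_add_cancel, Real.rpow_two]
    have e3 : M₁ ^ (2 - α / 2) = M₁ ^ (2 - α) * M₁ ^ (α / 2) := by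
      rw [← Real.rpow_add hM₁0]
      congr 1
      ring
    have e4 : M₂ ^ (α / 2) ≤ M₁ ^ (α / 2) := by gcongr
    rw [Real.mul_rpow hM₁0.le hM₂0.le, e1, e2, e3]
    calc _ ≤ M₁ ^ (2 - α) * (M₂ ^ (2 - α / 2) * M₁ ^ (α / 2)) := by gcongr
      _ = _ := by ring
  have hHβ : H ^ 2 * (Δ / H ^ β) = H ^ (2 - β) * Δ := by
    rw [Real.rpow_sub hH0, Real.rpow_two]
    ring
  have h32 : H * √H * (M₁ * √M₁ * (M₂ * √M₂)) = (M₁ * M₂) ^ ((3 : ℝ) / 2) * H ^ ((3 : ℝ) / 2) := by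
    rw [Real.mul_rpow hM₁0.le hM₂0.le, rpow_three_halves hH0, rpow_three_halves hM₁0,
      rpow_three_halves hM₂0]
    ring
  have hl : 0 ≤ 1 + Real.log (2 * M₁) := by
    have := Real.log_nonneg (by linarith : 1 ≤ 2 * M₁)
    linarith
  refine (Bcount_le_mul_log hα0 hα1 hβ0 hβ1 (by linarith) hM hH hΔ).trans ?_
  rw [h32, hHβ, Real.rpow_add hP0, Real.rpow_add hP0, ← hE, mul_assoc _ (1 + 1 / ε)]
  gcongr ?_ * ?_
  calc _ ≤ ((M₁ * M₂) ^ ((3 : ℝ) / 2) * H ^ ((3 : ℝ) / 2)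
        + H ^ (2 - β) * Δ * (M₁ * M₂) ^ (2 - α / 2)) * ((1 + 1 / ε) * E) := by gcongr
    _ = _ := by ring

theorem spacing_proposition (α β : ℝ)
    (hα0 : 0 < α) (hα1 : α < 1) (hβ0 : 0 < β) (hβ1 : β < 1)
    (ε : ℝ) (hε : 0 < ε) :
    ∃ C : ℝ, 0 < C ∧ ∀ M₁ M₂ H Δ : ℝ, 2 ≤ M₁ → 2 ≤ M₂ → 1 ≤ H → 0 < Δ →
      (Bcount α β M₁ M₂ H Δ : ℝ)
        ≤ C * ((M₁*M₂)^((3:ℝ)/2 + ε) * H^((3:ℝ)/2)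
          + M₁^(2 - α/4 + ε) * M₂^((3:ℝ)/2 + ε) * Δ^((1:ℝ)/4) * H^((3:ℝ)/2 - β/4)
          + (M₁*M₂)^(2 - α/2 + ε) * H^(2 - β) * Δ) := by
  have h1α : 0 < 1 - α := by linarith
  refine ⟨(3680 + 9216 / (α * (1 - α)) + 1280 / (α * β)) * (1 + 1 / ε), by positivity, ?_⟩
  intro M₁ M₂ H Δ hM₁ hM₂ hH hΔ
  have key : (Bcount α β M₁ M₂ H Δ : ℝ) ≤
      (3680 + 9216 / (α * (1 - α)) + 1280 / (α * β)) * (1 + 1 / ε) *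
        ((M₁ * M₂) ^ ((3 : ℝ) / 2 + ε) * H ^ ((3 : ℝ) / 2)
          + (M₁ * M₂) ^ (2 - α / 2 + ε) * H ^ (2 - β) * Δ) := by
    rcases le_total M₂ M₁ with h | h
    · exact Bcount_le_rpow hα0 hα1 hβ0 hβ1 hε hM₂ h hH hΔ
    · rw [mul_comm M₁ M₂]
      exact (Nat.cast_le.2 (Bcount_le_Bcount_swap α β M₁ M₂ H Δ)).trans
        (Bcount_le_rpow hα0 hα1 hβ0 hβ1 hε hM₁ h hH hΔ)
  refine key.trans ?_
  have : 0 ≤ M₁ ^ (2 - α / 4 + ε) * M₂ ^ ((3 : ℝ) / 2 + ε) * Δ ^ ((1 : ℝ) / 4)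
      * H ^ ((3 : ℝ) / 2 - β / 4) := by positivity
  gcongr
  linarith
end

section
/- Fix real numbers α, β with 0 < α < 1 and 0 < β < 1. Let m₁ > m₂ and m̃₁ > m̃₂ be positive integers, H ≥ 1 a real number, Δ > 0 a real number, and μ ≥ 1 an integer. Then the number of pairs of positive integers (h, h̃) with h, h̃ ~ H, gcd(h, h̃) = μ, and |(m₁^α − m₂^α)/(m̃₁^α − m̃₂^α) − (h/h̃)^β| ≤ Δ / ((m̃₁^α − m̃₂^α) H^β) is ≪ 1 + Δ (m̃₁^α − m̃₂^α)^{−1} H^{2−β} μ^{−2}, where the implied constant depends only on α, β. -/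
open Real Finset

theorem card_le_one_add_div_of_separated {ι : Type*} (S : Finset ι) (f : ι → ℝ) {s L : ℝ}
    (hs : 0 < s) (hL : 0 ≤ L) (hdiam : ∀ x ∈ S, ∀ y ∈ S, |f x - f y| ≤ L)
    (hsep : ∀ x ∈ S, ∀ y ∈ S, |f x - f y| < s → x = y) :
    (S.card : ℝ) ≤ 1 + L / s := by
  rcases S.eq_empty_or_nonempty with rfl | hne
  · simp only [card_empty, Nat.cast_zero]
    positivity
  obtain ⟨z, hz, hmin⟩ := S.exists_min_image f hne
  have hcard : S.card ≤ (range (⌊L / s⌋₊ + 1)).card := by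
    refine card_le_card_of_injOn (fun x => ⌊(f x - f z) / s⌋₊) ?_ ?_
    · intro x hx
      have h1 := (le_abs_self _).trans (hdiam x hx z hz)
      simp only [coe_range, Set.mem_Iio, Nat.lt_succ_iff]
      gcongr
    · intro x hx y hy hxy
      have hxy' : ⌊(f x - f z) / s⌋₊ = ⌊(f y - f z) / s⌋₊ := hxy
      have hx0 : 0 ≤ (f x - f z) / s := div_nonneg (sub_nonneg.2 (hmin x hx)) hs.le
      have hy0 : 0 ≤ (f y - f z) / s := div_nonneg (sub_nonneg.2 (hmin y hy)) hs.le
      have h1 := Nat.floor_le hx0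
      have h2 := Nat.lt_floor_add_one ((f x - f z) / s)
      have h3 := Nat.floor_le hy0
      have h4 := Nat.lt_floor_add_one ((f y - f z) / s)
      rw [hxy'] at h1 h2
      have h5 : |(f x - f z) / s - (f y - f z) / s| < 1 := by
        rw [abs_lt]
        constructor <;> linarith
      rw [← sub_div, sub_sub_sub_cancel_right, abs_div, abs_of_pos hs, div_lt_one hs] at h5
      exact hsep x hx y hy h5
  rw [card_range] at hcard
  have h1 : (S.card : ℝ) ≤ (⌊L / s⌋₊ : ℝ) + 1 := by exact_mod_cast hcard
  linarith [Nat.floor_le (div_nonneg hL hs.le)]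

theorem mul_sub_le_rpow_sub_rpow {β x y : ℝ} (hβ0 : 0 < β) (hβ1 : β < 1) (hy : 0 < y)
    (hyx : y ≤ x) (hx : x ≤ 2) : β / 2 * (x - y) ≤ x ^ β - y ^ β := by
  have hx0 : 0 < x := hy.trans_le hyx
  have hb : (1 + (y / x - 1)) ^ β ≤ 1 + β * (y / x - 1) :=
    rpow_one_add_le_one_add_mul_self (by linarith [div_pos hy hx0]) hβ0.le hβ1.le
  rw [add_sub_cancel, div_rpow hy.le hx0.le, div_le_iff₀ (rpow_pos_of_pos hx0 β)] at hb
  have hlow : x / 2 ≤ x ^ β := by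
    have h1 : (x / 2) ^ (1 : ℝ) ≤ (x / 2) ^ β :=
      rpow_le_rpow_of_exponent_ge (by positivity) (by linarith) hβ1.le
    rw [rpow_one] at h1
    exact h1.trans (rpow_le_rpow (by positivity) (by linarith) hβ0.le)
  have hr : 0 ≤ β * (1 - y / x) :=
    mul_nonneg hβ0.le (sub_nonneg.2 ((div_le_one hx0).2 hyx))
  calc β / 2 * (x - y) = β * (1 - y / x) * (x / 2) := by field_simp
    _ ≤ β * (1 - y / x) * x ^ β := by gcongr
    _ ≤ x ^ β - y ^ β := by linarith

theorem abs_sub_le_of_abs_rpow_sub_rpow_le {β x y δ : ℝ} (hβ0 : 0 < β) (hβ1 : β < 1)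
    (hx0 : 0 < x) (hy0 : 0 < y) (hx : x ≤ 2) (hy : y ≤ 2) (h : |x ^ β - y ^ β| ≤ δ) :
    |x - y| ≤ 2 * δ / β := by
  rw [le_div_iff₀ hβ0]
  rw [abs_le] at h
  rcases le_total y x with hyx | hxy
  · rw [abs_of_nonneg (sub_nonneg.2 hyx)]
    linarith [mul_sub_le_rpow_sub_rpow hβ0 hβ1 hy0 hyx hx]
  · rw [abs_of_nonpos (sub_nonpos.2 hxy)]
    linarith [mul_sub_le_rpow_sub_rpow hβ0 hβ1 hx0 hxy hy]

theorem eq_of_gcd_eq_of_mul_eq_mul {a b c d μ : ℕ} (hμ : 0 < μ) (hab : a.gcd b = μ)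
    (hcd : c.gcd d = μ) (h : a * d = c * b) : a = c ∧ b = d := by
  have h1 : a * μ = c * μ := by
    calc a * μ = (a * c).gcd (a * d) := by rw [Nat.gcd_mul_left, hcd]
      _ = (c * a).gcd (c * b) := by rw [h, mul_comm a c]
      _ = c * μ := by rw [Nat.gcd_mul_left, hab]
  have h2 : b * μ = d * μ := by
    calc b * μ = (b * c).gcd (b * d) := by rw [Nat.gcd_mul_left, hcd]
      _ = (d * a).gcd (d * b) := by rw [mul_comm b c, ← h, mul_comm a d, mul_comm b d]
      _ = d * μ := by rw [Nat.gcd_mul_left, hab]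
  exact ⟨Nat.eq_of_mul_eq_mul_right hμ h1, Nat.eq_of_mul_eq_mul_right hμ h2⟩

theorem eq_of_abs_div_sub_div_lt {a b c d μ : ℕ} {K : ℝ} (hμ : 0 < μ) (hab : a.gcd b = μ)
    (hcd : c.gcd d = μ) (hb : 0 < b) (hd : 0 < d) (hbK : (b : ℝ) ≤ K) (hdK : (d : ℝ) ≤ K)
    (h : |(a : ℝ) / b - (c : ℝ) / d| < (μ : ℝ) ^ 2 / K ^ 2) : a = c ∧ b = d := by
  have hb' : (0 : ℝ) < b := by exact_mod_cast hb
  have hd' : (0 : ℝ) < d := by exact_mod_cast hd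
  have hbd : (b : ℝ) * d ≤ K ^ 2 := by nlinarith
  refine eq_of_gcd_eq_of_mul_eq_mul hμ hab hcd ?_
  rw [div_sub_div _ _ hb'.ne' hd'.ne', abs_div, abs_of_pos (mul_pos hb' hd'),
    div_lt_iff₀ (mul_pos hb' hd')] at h
  have hlt : |(a : ℝ) * d - b * c| < (μ : ℝ) ^ 2 :=
    h.trans_le <| (mul_le_mul_of_nonneg_left hbd (by positivity)).trans_eq
      (div_mul_cancel₀ _ (pow_pos (hb'.trans_le hbK) 2).ne')
  have hlt' : |(a : ℤ) * d - b * c| < (μ : ℤ) ^ 2 := by exact_mod_cast hlt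
  have hμa : (μ : ℤ) ∣ a := by exact_mod_cast hab ▸ Nat.gcd_dvd_left a b
  have hμb : (μ : ℤ) ∣ b := by exact_mod_cast hab ▸ Nat.gcd_dvd_right a b
  have hμc : (μ : ℤ) ∣ c := by exact_mod_cast hcd ▸ Nat.gcd_dvd_left c d
  have hμd : (μ : ℤ) ∣ d := by exact_mod_cast hcd ▸ Nat.gcd_dvd_right c d
  have hdvd : (μ : ℤ) ^ 2 ∣ (a : ℤ) * d - b * c := by
    rw [sq]
    exact dvd_sub (mul_dvd_mul hμa hμd) (mul_dvd_mul hμb hμc)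
  have h0 := Int.eq_zero_of_abs_lt_dvd hdvd hlt'
  have h1 : (a : ℤ) * d = c * b := by linarith
  exact_mod_cast h1

theorem count_pairs_fixed_gcd (α β : ℝ)
    (hα0 : 0 < α) (hα1 : α < 1) (hβ0 : 0 < β) (hβ1 : β < 1) :
    ∃ C : ℝ, 0 < C ∧
      ∀ (m₁ m₂ mt₁ mt₂ : ℕ) (H Δ : ℝ) (μ : ℕ),
        0 < m₂ → m₂ < m₁ → 0 < mt₂ → mt₂ < mt₁ → 1 ≤ H → 0 < Δ → 1 ≤ μ →
        (((Finset.Ioc ⌊H⌋₊ ⌊2*H⌋₊ ×ˢ Finset.Ioc ⌊H⌋₊ ⌊2*H⌋₊).filter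
          (fun t : ℕ × ℕ => Nat.gcd t.1 t.2 = μ ∧
            |((m₁ : ℝ)^α - (m₂ : ℝ)^α) / ((mt₁ : ℝ)^α - (mt₂ : ℝ)^α)
              - ((t.1 : ℝ) / (t.2 : ℝ))^β|
            ≤ Δ / (((mt₁ : ℝ)^α - (mt₂ : ℝ)^α) * H^β))).card : ℝ)
        ≤ C * (1 + Δ * ((mt₁ : ℝ)^α - (mt₂ : ℝ)^α)⁻¹ * H^(2 - β) * ((μ : ℝ)^2)⁻¹) := by
  refine ⟨16 / β, by positivity, ?_⟩
  intro m₁ m₂ mt₁ mt₂ H Δ μ _ _ _ hmt hH hΔ hμ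
  have hH0 : 0 < H := by linarith
  have hμ0 : (0 : ℝ) < μ := by exact_mod_cast hμ
  have hD : 0 < (mt₁ : ℝ) ^ α - (mt₂ : ℝ) ^ α :=
    sub_pos.2 (rpow_lt_rpow (Nat.cast_nonneg _) (by exact_mod_cast hmt) hα0)
  set D := (mt₁ : ℝ) ^ α - (mt₂ : ℝ) ^ α
  set A := ((m₁ : ℝ) ^ α - (m₂ : ℝ) ^ α) / D
  have hHβ : 0 < H ^ β := rpow_pos_of_pos hH0 β
  set δ := Δ / (D * H ^ β) with hδ
  have hδ0 : 0 < δ := by positivity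
  have hrange : ∀ n ∈ Ioc ⌊H⌋₊ ⌊2 * H⌋₊, 0 < n ∧ H < n ∧ (n : ℝ) ≤ 2 * H := by
    intro n hn
    rw [mem_Ioc, Nat.floor_lt hH0.le, Nat.le_floor_iff (by positivity)] at hn
    exact ⟨by exact_mod_cast hH0.trans hn.1, hn⟩
  have hratio : ∀ a ∈ Ioc ⌊H⌋₊ ⌊2 * H⌋₊, ∀ b ∈ Ioc ⌊H⌋₊ ⌊2 * H⌋₊,
      0 < (a : ℝ) / b ∧ (a : ℝ) / b ≤ 2 := by
    intro a ha b hb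
    obtain ⟨_, ha1, ha2⟩ := hrange a ha
    obtain ⟨_, hb1, -⟩ := hrange b hb
    have hb0 := hH0.trans hb1
    exact ⟨div_pos (hH0.trans ha1) hb0, (div_le_iff₀ hb0).2 (by linarith)⟩
  refine (card_le_one_add_div_of_separated _ (fun t : ℕ × ℕ => (t.1 : ℝ) / t.2)
    (s := (μ : ℝ) ^ 2 / (2 * H) ^ 2) (L := 2 * (2 * δ) / β)
    (by positivity) (by positivity) ?_ ?_).trans ?_
  · rintro ⟨a, b⟩ ht ⟨c, d⟩ hu
    simp only [mem_filter, mem_product] at ht hu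
    obtain ⟨⟨ha, hb⟩, -, hab⟩ := ht
    obtain ⟨⟨hc, hd⟩, -, hcd⟩ := hu
    obtain ⟨h1, h2⟩ := hratio a ha b hb
    obtain ⟨h3, h4⟩ := hratio c hc d hd
    refine abs_sub_le_of_abs_rpow_sub_rpow_le hβ0 hβ1 h1 h3 h2 h4 ?_
    rw [abs_le] at *
    constructor <;> linarith
  · rintro ⟨a, b⟩ ht ⟨c, d⟩ hu h
    simp only [mem_filter, mem_product] at ht hu
    obtain ⟨hb, -, hb2⟩ := hrange b ht.1.2
    obtain ⟨hd, -, hd2⟩ := hrange d hu.1.2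
    exact Prod.ext_iff.2 (eq_of_abs_div_sub_div_lt hμ ht.2.1 hu.2.1 hb hd hb2 hd2 h)
  · have hpow : H ^ (2 - β) = H ^ 2 / H ^ β := by
      rw [rpow_sub hH0, rpow_two]
    have hmain : 2 * (2 * δ) / β / ((μ : ℝ) ^ 2 / (2 * H) ^ 2)
        = 16 / β * (Δ * D⁻¹ * H ^ (2 - β) * ((μ : ℝ) ^ 2)⁻¹) := by
      rw [hpow, hδ]
      field_simp
      ring
    have hC : 1 ≤ 16 / β := (one_le_div hβ0).2 (by linarith)
    rw [hmain, mul_add, mul_one]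
    gcongr
end

section
/- Fix real numbers α, β with 0 < α < 1 and 0 < β < 1. For M₁, M₂ ≥ 2, H ≥ 1 real and Δ > 0 real, let 𝓑(M₁,M₂,H,Δ) be the number of six-tuples (m₁, m̃₁, m₂, m̃₂, h, h̃) of positive integers with m₁, m̃₁ ~ M₁, m₂, m̃₂ ~ M₂, h, h̃ ~ H, m₁ ≠ m₂, m̃₁ ≠ m̃₂, satisfying |(m₁^α − m₂^α) h^β − (m̃₁^α − m̃₂^α) h̃^β| ≤ Δ. Then 𝓑(M₁,M₂,H,Δ) ≪ H M₁² M₂² + Δ (M₁M₂)^{2−α/2} H^{2−β} (log M₁)(log M₂), where the implied constant depends only on α, β. -/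
open Real Finset

theorem mul_abs_sub_le_rpow_mul_abs_rpow_sub {a x y B : ℝ} (ha0 : 0 < a) (ha1 : a < 1)
    (hx : 0 < x) (hy : 0 < y) (hxB : x ≤ B) (hyB : y ≤ B) :
    a * |x - y| ≤ B ^ (1 - a) * |x ^ a - y ^ a| := by
  wlog hxy : x ≤ y generalizing x y
  · rw [abs_sub_comm x, abs_sub_comm (x ^ a)]
    exact this hy hx hyB hxB (le_of_not_ge hxy)
  have hmono : x ^ a ≤ y ^ a := rpow_le_rpow hx.le hxy ha0.le
  have hB : y ^ (1 - a) ≤ B ^ (1 - a) := rpow_le_rpow hy.le hyB (by linarith)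
  have hgm := Real.geom_mean_le_arith_mean2_weighted (w₁ := 1 - a) (w₂ := a) (by linarith)
    ha0.le hy.le hx.le (by ring)
  have hsplit : y ^ (1 - a) * y ^ a = y := by
    rw [← rpow_add hy]; simp
  rw [abs_sub_comm x, abs_sub_comm (x ^ a), abs_of_nonneg (by linarith),
    abs_of_nonneg (by linarith)]
  calc a * (y - x) ≤ y ^ (1 - a) * (y ^ a - x ^ a) := by rw [mul_sub (y ^ (1 - a)), hsplit]; linarith
    _ ≤ B ^ (1 - a) * (y ^ a - x ^ a) := mul_le_mul_of_nonneg_right hB (by linarith)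

theorem two_mul_rpow_le {x p : ℝ} (hx : 0 ≤ x) (hp : p ≤ 1) : (2 * x) ^ p ≤ 2 * x ^ p := by
  rw [mul_rpow (by norm_num) hx]
  gcongr
  simpa using rpow_le_rpow_of_exponent_le (x := 2) (by norm_num) hp

theorem Finset.card_le_add_one_of_sub_le (T : Finset ℕ) {L : ℝ} (hL : 0 ≤ L)
    (hT : ∀ x ∈ T, ∀ y ∈ T, (y : ℝ) - x ≤ L) : (T.card : ℝ) ≤ L + 1 := by
  rcases T.eq_empty_or_nonempty with rfl | hne
  · simp; linarith
  have hsub : T ⊆ Finset.Icc (T.min' hne) (T.max' hne) := fun x hx =>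
    Finset.mem_Icc.2 ⟨T.min'_le x hx, T.le_max' x hx⟩
  have hcard := Finset.card_le_card hsub
  rw [Nat.card_Icc] at hcard
  have hmm : T.min' hne ≤ T.max' hne := T.min'_le _ (T.max'_mem hne)
  have hdiff := hT _ (T.min'_mem hne) _ (T.max'_mem hne)
  have : (T.card : ℝ) + T.min' hne ≤ T.max' hne + 1 := by
    have : T.card + T.min' hne ≤ T.max' hne + 1 := by omega
    exact_mod_cast this
  linarith

theorem mem_Ioc_floor_two_mul {M : ℝ} (hM : 0 ≤ M) {n : ℕ}
    (hn : n ∈ Finset.Ioc ⌊M⌋₊ ⌊2 * M⌋₊) : 0 < n ∧ (n : ℝ) ≤ 2 * M := by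
  rw [Finset.mem_Ioc] at hn
  exact ⟨by omega, (Nat.le_floor_iff (by positivity)).1 hn.2⟩

theorem card_Ioc_floor_two_mul_le {M : ℝ} (hM : 0 ≤ M) :
    ((Finset.Ioc ⌊M⌋₊ ⌊2 * M⌋₊).card : ℝ) ≤ 2 * M := by
  rw [Nat.card_Ioc]
  refine le_trans ?_ (Nat.floor_le (by positivity : 0 ≤ 2 * M))
  exact_mod_cast Nat.sub_le _ _

theorem sum_abs_sub_inv_le {N m : ℕ} (s : Finset ℕ) (hs : ∀ n ∈ s, 0 < n ∧ n ≤ N)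
    (hm0 : 0 < m) (hm : m ≤ N) :
    ∑ n ∈ s, |(m : ℝ) - n|⁻¹ ≤ 2 * (1 + Real.log N) := by
  have hharm : ∑ k ∈ Finset.Icc 1 N, (k : ℝ)⁻¹ ≤ 1 + Real.log N := by
    have h := harmonic_le_one_add_log N
    rw [harmonic_eq_sum_Icc] at h
    push_cast at h
    exact h
  have hinj : ∀ (t : Finset ℕ) (e : ℕ → ℕ), Set.InjOn e t → (∀ n ∈ t, e n ∈ Finset.Icc 1 N) →
      (∀ n ∈ t, |(m : ℝ) - n| = e n) → ∑ n ∈ t, |(m : ℝ) - n|⁻¹ ≤ 1 + Real.log N := by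
    intro t e he hmem hval
    calc ∑ n ∈ t, |(m : ℝ) - n|⁻¹ = ∑ k ∈ t.image e, (k : ℝ)⁻¹ := by
          rw [Finset.sum_image he]
          exact Finset.sum_congr rfl fun n hn => by rw [hval n hn]
      _ ≤ ∑ k ∈ Finset.Icc 1 N, (k : ℝ)⁻¹ :=
          Finset.sum_le_sum_of_subset_of_nonneg (Finset.image_subset_iff.2 hmem)
            fun _ _ _ => by positivity
      _ ≤ _ := hharm
  have hlt := hinj (s.filter (· < m)) (fun n => m - n)
    (by intro a ha b hb h; simp at ha hb h; omega)
    (by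
      intro n hn
      rw [Finset.mem_filter] at hn
      rw [Finset.mem_Icc]; omega)
    (by
      intro n hn
      rw [Finset.mem_filter] at hn
      rw [Nat.cast_sub hn.2.le, abs_of_nonneg]
      exact sub_nonneg.2 (by exact_mod_cast hn.2.le))
  have hge : ∑ n ∈ s.filter (¬ · < m), |(m : ℝ) - n|⁻¹ ≤ 1 + Real.log N := by
    have hgt := hinj (s.filter (m < ·)) (fun n => n - m)
      (by intro a ha b hb h; simp at ha hb h; omega)
      (by
        intro n hn
        rw [Finset.mem_filter] at hn
        have := hs n hn.1
        rw [Finset.mem_Icc]; omega)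
      (by
        intro n hn
        rw [Finset.mem_filter] at hn
        rw [Nat.cast_sub hn.2.le, abs_sub_comm, abs_of_nonneg]
        exact sub_nonneg.2 (by exact_mod_cast hn.2.le))
    refine le_trans (le_of_eq ?_) hgt
    symm
    apply Finset.sum_subset
    · intro n hn
      simp only [Finset.mem_filter] at hn ⊢
      exact ⟨hn.1, by omega⟩
    · intro n hn hn'
      simp only [Finset.mem_filter] at hn hn'
      have : n = m := by
        by_contra hne
        exact hn' ⟨hn.1, by omega⟩
      simp [this]
  rw [← Finset.sum_filter_add_sum_filter_not s (· < m)]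
  linarith

theorem sum_sum_abs_rpow_sub_inv_le {α M₁ M₂ : ℝ} (hα0 : 0 < α) (hα1 : α < 1)
    (hM₁ : 2 ≤ M₁) (hM₂ : 2 ≤ M₂) (h12 : M₁ ≤ M₂) :
    ∑ m ∈ Finset.Ioc ⌊M₁⌋₊ ⌊2 * M₁⌋₊, ∑ n ∈ Finset.Ioc ⌊M₂⌋₊ ⌊2 * M₂⌋₊,
      |(m : ℝ) ^ α - (n : ℝ) ^ α|⁻¹
      ≤ 64 / α * ((M₁ * M₂) ^ (1 - α / 2) * Real.log M₁ * Real.log M₂) := by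
  have hlog2 := Real.log_two_gt_d9
  have hl1 : Real.log 2 ≤ Real.log M₁ := Real.log_le_log (by norm_num) hM₁
  have hl2 : Real.log 2 ≤ Real.log M₂ := Real.log_le_log (by norm_num) hM₂
  have hp1 : 0 < M₁ := by linarith
  have hp2 : 0 < M₂ := by linarith
  have hlogN : 2 * (1 + Real.log (⌊2 * M₂⌋₊ : ℝ)) ≤ 8 * Real.log M₂ := by
    have hpos : 0 < ⌊2 * M₂⌋₊ := Nat.floor_pos.2 (by linarith)
    have : Real.log (⌊2 * M₂⌋₊ : ℝ) ≤ Real.log (2 * M₂) :=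
      Real.log_le_log (by exact_mod_cast hpos) (Nat.floor_le (by positivity))
    rw [Real.log_mul (by norm_num) hp2.ne'] at this
    linarith
  have hpow : (2 * M₂) ^ (1 - α) ≤ 2 * M₂ ^ (1 - α) :=
    two_mul_rpow_le hp2.le (by linarith)
  have hterm : ∀ m ∈ Finset.Ioc ⌊M₁⌋₊ ⌊2 * M₁⌋₊, ∀ n ∈ Finset.Ioc ⌊M₂⌋₊ ⌊2 * M₂⌋₊,
      |(m : ℝ) ^ α - (n : ℝ) ^ α|⁻¹ ≤ 2 * M₂ ^ (1 - α) / α * |(m : ℝ) - n|⁻¹ := by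
    intro m hm n hn
    obtain ⟨hm0, hmM⟩ := mem_Ioc_floor_two_mul hp1.le hm
    obtain ⟨hn0, hnM⟩ := mem_Ioc_floor_two_mul hp2.le hn
    have hkey := mul_abs_sub_le_rpow_mul_abs_rpow_sub (B := 2 * M₂) hα0 hα1
      (Nat.cast_pos.2 hm0) (Nat.cast_pos.2 hn0) (by linarith) hnM
    rcases eq_or_ne m n with rfl | hne
    · simp
    have hd : 0 < |(m : ℝ) - n| := abs_pos.2 (sub_ne_zero.2 (by exact_mod_cast hne))
    have hb : 0 < |(m : ℝ) ^ α - (n : ℝ) ^ α| := by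
      by_contra h
      rw [le_antisymm (not_lt.1 h) (abs_nonneg _), mul_zero] at hkey
      nlinarith [mul_pos hα0 hd]
    have hkey' := hkey.trans (mul_le_mul_of_nonneg_right hpow hb.le)
    rw [← div_eq_mul_inv, div_div, inv_le_iff_one_le_mul₀ hb, div_mul_eq_mul_div,
      one_le_div (by positivity)]
    exact hkey'
  have hsplit : M₁ * M₂ ^ (1 - α) ≤ (M₁ * M₂) ^ (1 - α / 2) := by
    have e1 : M₁ = M₁ ^ (1 - α / 2) * M₁ ^ (α / 2) := by rw [← rpow_add hp1]; simp
    have e2 : M₂ ^ (1 - α / 2) = M₂ ^ (α / 2) * M₂ ^ (1 - α) := by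
      rw [← rpow_add hp2]; ring_nf
    rw [mul_rpow hp1.le hp2.le, e2, ← mul_assoc]
    have : M₁ ^ (α / 2) ≤ M₂ ^ (α / 2) := rpow_le_rpow hp1.le h12 (by positivity)
    calc M₁ * M₂ ^ (1 - α) = M₁ ^ (1 - α / 2) * M₁ ^ (α / 2) * M₂ ^ (1 - α) := by rw [← e1]
      _ ≤ _ := by gcongr
  have hl1' : 1 ≤ 2 * Real.log M₁ := by linarith
  calc _ ≤ ∑ m ∈ Finset.Ioc ⌊M₁⌋₊ ⌊2 * M₁⌋₊, 2 * M₂ ^ (1 - α) / α * (8 * Real.log M₂) := by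
        refine Finset.sum_le_sum fun m hm => (Finset.sum_le_sum (hterm m hm)).trans ?_
        rw [← Finset.mul_sum]
        refine mul_le_mul_of_nonneg_left (le_trans (sum_abs_sub_inv_le _ (N := ⌊2 * M₂⌋₊) ?_ ?_ ?_)
          hlogN) (by positivity)
        · intro n hn
          exact ⟨(mem_Ioc_floor_two_mul hp2.le hn).1, (Finset.mem_Ioc.1 hn).2⟩
        · exact (mem_Ioc_floor_two_mul hp1.le hm).1
        · exact (Finset.mem_Ioc.1 hm).2.trans (Nat.floor_le_floor (by linarith))
    _ ≤ 2 * M₁ * (2 * M₂ ^ (1 - α) / α * (8 * Real.log M₂)) := by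
        rw [Finset.sum_const, nsmul_eq_mul]
        have : 0 ≤ Real.log M₂ := by linarith
        exact mul_le_mul_of_nonneg_right (card_Ioc_floor_two_mul_le hp1.le) (by positivity)
    _ = 32 / α * Real.log M₂ * (M₁ * M₂ ^ (1 - α) * 1) := by ring
    _ ≤ 32 / α * Real.log M₂ * ((M₁ * M₂) ^ (1 - α / 2) * (2 * Real.log M₁)) := by
        have : 0 ≤ Real.log M₂ := by linarith
        gcongr
    _ = _ := by ring

theorem sum_sum_abs_rpow_sub_inv_le' {α M₁ M₂ : ℝ} (hα0 : 0 < α) (hα1 : α < 1)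
    (hM₁ : 2 ≤ M₁) (hM₂ : 2 ≤ M₂) :
    ∑ m ∈ Finset.Ioc ⌊M₁⌋₊ ⌊2 * M₁⌋₊, ∑ n ∈ Finset.Ioc ⌊M₂⌋₊ ⌊2 * M₂⌋₊,
      |(m : ℝ) ^ α - (n : ℝ) ^ α|⁻¹
      ≤ 64 / α * ((M₁ * M₂) ^ (1 - α / 2) * Real.log M₁ * Real.log M₂) := by
  rcases le_total M₁ M₂ with h | h
  · exact sum_sum_abs_rpow_sub_inv_le hα0 hα1 hM₁ hM₂ h
  · have := sum_sum_abs_rpow_sub_inv_le hα0 hα1 hM₂ hM₁ h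
    rw [Finset.sum_comm, mul_comm M₁, mul_right_comm]
    simpa only [abs_sub_comm] using this

theorem card_filter_abs_sub_mul_rpow_le {β H Δ A b : ℝ} (hβ0 : 0 < β) (hβ1 : β < 1)
    (hH : 1 ≤ H) (hΔ : 0 < Δ) (hb : b ≠ 0) :
    (((Finset.Ioc ⌊H⌋₊ ⌊2 * H⌋₊).filter (fun h : ℕ => |A - b * (h : ℝ) ^ β| ≤ Δ)).card : ℝ)
      ≤ 4 / β * Δ * H ^ (1 - β) * |b|⁻¹ + 1 := by
  have hH0 : 0 < H := by linarith
  have hb' : 0 < |b| := abs_pos.2 hb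
  refine Finset.card_le_add_one_of_sub_le _ (by positivity) ?_
  intro x hx y hy
  rw [Finset.mem_filter] at hx hy
  obtain ⟨hx0, hxH⟩ := mem_Ioc_floor_two_mul hH0.le hx.1
  obtain ⟨hy0, hyH⟩ := mem_Ioc_floor_two_mul hH0.le hy.1
  have hkey := mul_abs_sub_le_rpow_mul_abs_rpow_sub (B := 2 * H) hβ0 hβ1
      (Nat.cast_pos.2 hy0) (Nat.cast_pos.2 hx0) hyH hxH
  have hpow : (2 * H) ^ (1 - β) ≤ 2 * H ^ (1 - β) :=
    two_mul_rpow_le hH0.le (by linarith)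
  have hdiff : |(y : ℝ) ^ β - (x : ℝ) ^ β| ≤ 2 * Δ * |b|⁻¹ := by
    rw [← div_eq_mul_inv, le_div_iff₀ hb', ← abs_mul]
    calc |((y : ℝ) ^ β - (x : ℝ) ^ β) * b|
        = |(A - b * (x : ℝ) ^ β) - (A - b * (y : ℝ) ^ β)| := by ring_nf
      _ ≤ _ := (abs_sub _ _).trans (by linarith [hx.2, hy.2])
  have hfin : β * |(y : ℝ) - x| ≤ 2 * H ^ (1 - β) * (2 * Δ * |b|⁻¹) :=
    hkey.trans (mul_le_mul hpow hdiff (abs_nonneg _) (by positivity))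
  calc (y : ℝ) - x ≤ |(y : ℝ) - x| := le_abs_self _
    _ ≤ 2 * H ^ (1 - β) * (2 * Δ * |b|⁻¹) / β := by rw [le_div_iff₀ hβ0]; linarith
    _ = _ := by ring

theorem Bcount_le_sum {α β M₁ M₂ H Δ : ℝ} (hα0 : 0 < α)
    (hβ0 : 0 < β) (hβ1 : β < 1) (hH : 1 ≤ H) (hΔ : 0 < Δ) :
    (Bcount α β M₁ M₂ H Δ : ℝ) ≤
      ∑ _m₁ ∈ Finset.Ioc ⌊M₁⌋₊ ⌊2 * M₁⌋₊, ∑ n₁ ∈ Finset.Ioc ⌊M₁⌋₊ ⌊2 * M₁⌋₊,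
      ∑ _m₂ ∈ Finset.Ioc ⌊M₂⌋₊ ⌊2 * M₂⌋₊, ∑ n₂ ∈ Finset.Ioc ⌊M₂⌋₊ ⌊2 * M₂⌋₊,
      ∑ _h ∈ Finset.Ioc ⌊H⌋₊ ⌊2 * H⌋₊,
        (4 / β * Δ * H ^ (1 - β) * |(n₁ : ℝ) ^ α - (n₂ : ℝ) ^ α|⁻¹ + 1) := by
  have hH0 : 0 < H := by linarith
  rw [Bcount, Finset.card_filter]
  push_cast
  simp only [Finset.sum_product]
  refine Finset.sum_le_sum fun m₁ _ => Finset.sum_le_sum fun n₁ _ => Finset.sum_le_sum fun m₂ _ =>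
    Finset.sum_le_sum fun n₂ _ => Finset.sum_le_sum fun h _ => ?_
  by_cases hn : n₁ = n₂
  · simp [hn]
  have hb : (n₁ : ℝ) ^ α - (n₂ : ℝ) ^ α ≠ 0 := by
    rw [sub_ne_zero, Ne, Real.rpow_left_inj (Nat.cast_nonneg _) (Nat.cast_nonneg _) hα0.ne']
    exact_mod_cast hn
  refine le_trans ?_ (card_filter_abs_sub_mul_rpow_le
    (A := ((m₁ : ℝ) ^ α - (m₂ : ℝ) ^ α) * (h : ℝ) ^ β) hβ0 hβ1 hH hΔ hb)
  rw [Finset.card_filter]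
  push_cast
  refine Finset.sum_le_sum fun k _ => ?_
  split_ifs with h1 h2 h2
  · exact le_rfl
  · exact absurd h1.2.2 h2
  · exact zero_le_one
  · exact le_rfl

theorem spacing_count_h_aspect (α β : ℝ)
    (hα0 : 0 < α) (hα1 : α < 1) (hβ0 : 0 < β) (hβ1 : β < 1) :
    ∃ C : ℝ, 0 < C ∧ ∀ M₁ M₂ H Δ : ℝ, 2 ≤ M₁ → 2 ≤ M₂ → 1 ≤ H → 0 < Δ →
      (Bcount α β M₁ M₂ H Δ : ℝ)
        ≤ C * (H * M₁^2 * M₂^2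
          + Δ * (M₁*M₂)^(2 - α/2) * H^(2 - β) * Real.log M₁ * Real.log M₂) := by
  refine ⟨32 + 2048 / (α * β), by positivity, fun M₁ M₂ H Δ hM₁ hM₂ hH hΔ => ?_⟩
  have hp1 : 0 < M₁ := by linarith
  have hp2 : 0 < M₂ := by linarith
  have hH0 : 0 < H := by linarith
  have hl1 : 0 ≤ Real.log M₁ := Real.log_nonneg (by linarith)
  have hl2 : 0 ≤ Real.log M₂ := Real.log_nonneg (by linarith)
  have hS := sum_sum_abs_rpow_sub_inv_le' hα0 hα1 hM₁ hM₂
  refine (Bcount_le_sum hα0 hβ0 hβ1 hH hΔ).trans ?_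
  have hc1 := card_Ioc_floor_two_mul_le hp1.le
  have hc2 := card_Ioc_floor_two_mul_le hp2.le
  have hcH := card_Ioc_floor_two_mul_le hH0.le
  simp only [Finset.sum_const, nsmul_eq_mul, ← Finset.mul_sum, Finset.sum_add_distrib, mul_one]
  set S := ∑ m ∈ Finset.Ioc ⌊M₁⌋₊ ⌊2 * M₁⌋₊, ∑ n ∈ Finset.Ioc ⌊M₂⌋₊ ⌊2 * M₂⌋₊,
      |(m : ℝ) ^ α - (n : ℝ) ^ α|⁻¹
  set c₁ : ℝ := ((Finset.Ioc ⌊M₁⌋₊ ⌊2 * M₁⌋₊).card : ℝ)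
  set c₂ : ℝ := ((Finset.Ioc ⌊M₂⌋₊ ⌊2 * M₂⌋₊).card : ℝ)
  set c : ℝ := ((Finset.Ioc ⌊H⌋₊ ⌊2 * H⌋₊).card : ℝ)
  have hS0 : 0 ≤ S := Finset.sum_nonneg fun _ _ => Finset.sum_nonneg fun _ _ => by positivity
  have eM : (M₁ * M₂) ^ (2 - α / 2) = (M₁ * M₂) * (M₁ * M₂) ^ (1 - α / 2) := by
    rw [← rpow_one_add' (by positivity) (by linarith)]; ring_nf
  have eH : H ^ (2 - β) = H * H ^ (1 - β) := by
    rw [← rpow_one_add' (by positivity) (by linarith)]; ring_nf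
  calc _ = c₁ * c₂ * c * (4 / β * Δ * H ^ (1 - β) * S + c₁ * c₂) := by ring
    _ ≤ (2 * M₁) * (2 * M₂) * (2 * H) * (4 / β * Δ * H ^ (1 - β) *
          (64 / α * ((M₁ * M₂) ^ (1 - α / 2) * Real.log M₁ * Real.log M₂))
          + (2 * M₁) * (2 * M₂)) := by gcongr
    _ = 32 * (H * M₁^2 * M₂^2) + 2048 / (α * β) *
          (Δ * (M₁*M₂)^(2 - α/2) * H^(2 - β) * Real.log M₁ * Real.log M₂) := by
        rw [eM, eH]; field_simp; ring
    _ ≤ _ := by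
        have h1 : 0 ≤ H * M₁^2 * M₂^2 := by positivity
        have h2 : 0 ≤ Δ * (M₁*M₂)^(2 - α/2) * H^(2 - β) * Real.log M₁ * Real.log M₂ := by
          positivity
        have h3 : 0 < 2048 / (α * β) := by positivity
        nlinarith [mul_nonneg h3.le h1]
end
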